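/- arXiv:1201.2157 — 3 statements merged into one kernel-verified Lean document; each statement's English description precedes it below -/
import Mathlib

section
/- Fix θ > 0 and a dashed pattern (τ, X) of size p, and set q = |X|. For each N let σ_N be an Ewens(θ)-distributed random permutation of S_N. Then there exists a real number V_{τ,X} ≥ 0 such that Z^{(N)} = √N ( O^{(N)}_{τ,X}(σ_N)/N^{p−q} − 1/(p!(p−q)!) ) converges in distribution, as N → ∞, to a centered Gaussian random variable with variance V_{τ,X}. -/
open scoped BigOperators Classical
open Finset

noncomputable section

/-- Total number of cycles of a permutation of `Fin N`, fixed points included. -/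
def cycleCount {N : ℕ} (σ : Equiv.Perm (Fin N)) : ℕ :=
  Multiset.card σ.cycleType + (N - σ.cycleType.sum)

/-- Expectation of `f` under the Ewens measure with parameter `θ` on `S_N`. -/
def ewensE (θ : ℝ) (N : ℕ) (f : Equiv.Perm (Fin N) → ℝ) : ℝ :=
  (∑ σ : Equiv.Perm (Fin N), θ ^ cycleCount σ * f σ) / ∏ k ∈ Finset.range N, (θ + (k : ℝ))

/-- Probability of an event under the Ewens measure. -/
def ewensP (θ : ℝ) (N : ℕ) (A : Set (Equiv.Perm (Fin N))) : ℝ :=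
  ewensE θ N (fun σ => if σ ∈ A then 1 else 0)

/-- The Bernoulli random variable `B^{(N)}_{i,s}`, equal to 1 iff `σ i = s`. -/
def Bis {N : ℕ} (i s : Fin N) (σ : Equiv.Perm (Fin N)) : ℝ :=
  if σ i = s then 1 else 0

/-- The set partitions of a finset `S`, encoded as finsets of nonempty disjoint finsets
covering `S`. -/
def partitionsOf {ι : Type*} [DecidableEq ι] (S : Finset ι) : Finset (Finset (Finset ι)) :=
  S.powerset.powerset.filter
    (fun P => (∀ C ∈ P, C.Nonempty) ∧ ∀ j ∈ S, ∃! C, C ∈ P ∧ j ∈ C)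

/-- The joint cumulant of the family of random variables indexed by `S`, expressed through
the moments function `M` : `κ = Σ_π (−1)^{#π−1} (#π−1)! Π_{C ∈ π} M C`. -/
def cumulantOn {ι 𝕜 : Type*} [DecidableEq ι] [Field 𝕜] (S : Finset ι) (M : Finset ι → 𝕜) : 𝕜 :=
  ∑ P ∈ partitionsOf S,
    (-1 : 𝕜) ^ (P.card - 1) * ((P.card - 1).factorial : 𝕜) * ∏ C ∈ P, M C


/-- Number of occurrences of the dashed pattern `(τ, X)` in `σ`: strictly increasing lists
`i_1 < ⋯ < i_p` such that `i_{x+1} = i_x + 1` for every `x ∈ X` and `σ(i_1),…,σ(i_p)` is in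
the same relative order as `τ(1),…,τ(p)`. -/
def occCount {N p : ℕ} (τ : Equiv.Perm (Fin p)) (X : Finset (Fin (p - 1)))
    (σ : Equiv.Perm (Fin N)) : ℕ :=
  (Finset.univ.filter (fun f : Fin p → Fin N =>
    StrictMono f ∧
    (∀ x ∈ X, (f ⟨(x : ℕ) + 1, by have := x.isLt; omega⟩ : ℕ)
      = (f ⟨(x : ℕ), by have := x.isLt; omega⟩ : ℕ) + 1) ∧
    (∀ a b : Fin p, σ (f a) < σ (f b) ↔ τ a < τ b))).card

section CycleCount

open Equiv Equiv.Perm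

lemma card_cycleType_swap_mul {α : Type*} [Fintype α] [DecidableEq α] (f : Perm α) {x y : α}
    (hx : f x = x) (hxy : x ≠ y) :
    Multiset.card (swap x y * f).cycleType + f.support.card + 1
      = Multiset.card f.cycleType + (swap x y * f).support.card := by
  by_cases hy : f y = y
  · have hd : Perm.Disjoint (swap x y) f := by
      intro z
      by_cases h1 : z = x
      · right; rw [h1, hx]
      by_cases h2 : z = y
      · right; rw [h2, hy]
      · left; exact swap_apply_of_ne_of_ne h1 h2
    rw [hd.cycleType_mul, hd.card_support_mul, (isCycle_swap hxy).cycleType, card_support_swap hxy]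
    simp; omega
  · have hys : y ∈ f.support := mem_support.2 hy
    set c := f.cycleOf y with hc
    have hmem : c ∈ f.cycleFactorsFinset := cycleOf_mem_cycleFactorsFinset_iff.2 hys
    have hd : Perm.Disjoint (f * c⁻¹) c := disjoint_mul_inv_of_mem_cycleFactorsFinset hmem
    have hfc : f = c * (f * c⁻¹) := by rw [hd.symm.commute.eq]; simp
    obtain ⟨l, hl⟩ : ∃ l, toList f y = y :: l := by
      have h0 := toList_getElem_zero f y hys
      rcases h : toList f y with _ | ⟨a, l⟩
      · rw [toList_eq_nil_iff] at h; exact absurd hys h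
      · simp only [h, List.getElem_cons_zero] at h0
        exact ⟨l, by rw [h0]⟩
    have hcl : c = List.formPerm (y :: l) := by rw [hc, ← formPerm_toList, hl]
    have hnd : (y :: l).Nodup := hl ▸ nodup_toList f y
    have hxl : x ∉ y :: l := by
      rw [← hl, mem_toList_iff]
      rintro ⟨h, -⟩
      exact hxy (h.symm.eq_of_left hx)
    have hlen : 2 ≤ (y :: l).length := by
      rw [← hl]; exact (two_le_length_toList_iff_mem_support).2 hys
    have hnd' : (x :: y :: l).Nodup := List.nodup_cons.2 ⟨hxl, hnd⟩
    have hs : swap x y * c = List.formPerm (x :: y :: l) := by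
      rw [hcl, List.formPerm_cons_cons]
    have hc1 : c.IsCycle := isCycle_cycleOf f hy
    have hc2 : (swap x y * c).IsCycle := by
      rw [hs]; exact List.isCycle_formPerm hnd' (by simp)
    have hsc : c.support = (y :: l).toFinset := by
      rw [hcl]; refine List.support_formPerm_of_nodup _ hnd ?_
      rintro z hz; rw [hz] at hlen; simp at hlen
    have hsc2 : (swap x y * c).support = (x :: y :: l).toFinset := by
      rw [hs]; refine List.support_formPerm_of_nodup _ hnd' ?_
      rintro z hz; simp at hz
    have hcard2 : (swap x y * c).support.card = c.support.card + 1 := by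
      rw [hsc, hsc2, List.toFinset_card_of_nodup hnd, List.toFinset_card_of_nodup hnd']; simp
    have hxr : (f * c⁻¹) x = x := by
      have : c x = x := by
        rw [← notMem_support, hsc]; simpa using hxl
      rw [mul_apply, inv_eq_iff_eq.2 this.symm, hx]
    have hd2 : Perm.Disjoint (swap x y * c) (f * c⁻¹) := by
      rw [disjoint_iff_disjoint_support, Finset.disjoint_left]
      intro z hz hz2
      rw [hsc2, List.toFinset_cons, Finset.mem_insert, ← hsc] at hz
      rcases hz with rfl | hz
      · exact (mem_support.1 hz2) hxr
      · exact Finset.disjoint_left.1 (disjoint_iff_disjoint_support.1 hd) hz2 hz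
    have e1 : Multiset.card f.cycleType = 1 + Multiset.card (f * c⁻¹).cycleType := by
      conv_lhs => rw [hfc]
      rw [hd.symm.cycleType_mul, hc1.cycleType]; simp [add_comm]
    have e2 : f.support.card = c.support.card + (f * c⁻¹).support.card := by
      conv_lhs => rw [hfc]
      rw [hd.symm.card_support_mul]
    have e3 : swap x y * f = (swap x y * c) * (f * c⁻¹) := by
      conv_lhs => rw [hfc]
      rw [mul_assoc]
    rw [e1, e2, e3, hd2.cycleType_mul, hc2.cycleType, hd2.card_support_mul, hcard2]
    simp; omega

lemma decomposeFin_symm_eq_swap_mul {N : ℕ} (j : Fin (N + 1)) (σ : Perm (Fin N)) :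
    decomposeFin.symm (j, σ) = swap 0 j * decomposeFin.symm (0, σ) := by
  ext i
  refine Fin.cases ?_ (fun i => ?_) i <;> simp

lemma decomposeFin_symm_mul {N : ℕ} (σ ρ : Perm (Fin N)) :
    decomposeFin.symm (0, σ * ρ) = decomposeFin.symm (0, σ) * decomposeFin.symm (0, ρ) := by
  ext i
  refine Fin.cases ?_ (fun i => ?_) i <;> simp

lemma decomposeFin_symm_zero_swap {N : ℕ} (a b : Fin N) :
    decomposeFin.symm (0, swap a b) = swap a.succ b.succ := by
  ext i
  refine Fin.cases ?_ (fun i => ?_) i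
  · simp [swap_apply_of_ne_of_ne, (Fin.succ_ne_zero _).symm]
  · simp [(Fin.succ_injective N).map_swap]

lemma decomposeFin_symm_zero_cycleType {N : ℕ} (σ : Perm (Fin N)) :
    (decomposeFin.symm (0, σ)).cycleType = σ.cycleType := by
  have h : decomposeFin.symm (0, σ) = σ.extendDomain (finSuccAboveEquiv (0 : Fin (N+1))) := by
    ext i
    refine Fin.cases ?_ (fun i => ?_) i
    · rw [extendDomain_apply_not_subtype] <;> simp
    · have := extendDomain_apply_image σ (finSuccAboveEquiv (0 : Fin (N+1))) i
      simp only [finSuccAboveEquiv_apply, Fin.zero_succAbove] at this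
      simp [this]
  rw [h, cycleType_extendDomain]

lemma cycleCount_decomposeFin_symm {N : ℕ} (j : Fin (N + 1)) (σ : Perm (Fin N)) :
    cycleCount (decomposeFin.symm (j, σ)) = cycleCount σ + if j = 0 then 1 else 0 := by
  have hct := decomposeFin_symm_zero_cycleType σ
  have h1 : σ.support.card ≤ N := by simpa using σ.support.card_le_univ
  have hs : (decomposeFin.symm (0, σ)).support.card = σ.support.card := by
    rw [← sum_cycleType, ← sum_cycleType, hct]
  unfold cycleCount
  by_cases hj : j = 0
  · subst hj
    simp only [sum_cycleType, hct, if_true]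
    omega
  · rw [decomposeFin_symm_eq_swap_mul, if_neg hj]
    have := card_cycleType_swap_mul (decomposeFin.symm (0, σ)) (x := 0) (y := j) (by simp)
      (Ne.symm hj)
    have h2 : (swap 0 j * decomposeFin.symm (0, σ)).support.card ≤ N + 1 := by
      simpa using (swap 0 j * decomposeFin.symm (0, σ)).support.card_le_univ
    rw [hct, hs] at this
    rw [sum_cycleType, sum_cycleType]
    omega

end CycleCount

/-- The Ewens weight of a permutation. -/
def ewensW (θ : ℝ) {N : ℕ} (σ : Equiv.Perm (Fin N)) : ℝ :=
  θ ^ cycleCount σ / ∏ k ∈ Finset.range N, (θ + (k : ℝ))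

lemma ewensE_eq_sum (θ : ℝ) (N : ℕ) (f : Equiv.Perm (Fin N) → ℝ) :
    ewensE θ N f = ∑ σ, ewensW θ σ * f σ := by
  simp only [ewensE, ewensW, Finset.sum_div]
  exact Finset.sum_congr rfl fun σ _ => by ring

lemma ewensW_nonneg {θ : ℝ} (hθ : 0 < θ) {N : ℕ} (σ : Equiv.Perm (Fin N)) : 0 ≤ ewensW θ σ :=
  div_nonneg (by positivity) (Finset.prod_nonneg fun k _ => by positivity)

/-- The law of the insertion position in the recursive construction of Ewens permutations. -/
def insertionW (θ : ℝ) (N : ℕ) (j : Fin (N + 1)) : ℝ :=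
  (if j = 0 then θ else 1) / (θ + N)

lemma ewensW_decomposeFin_symm {θ : ℝ} {N : ℕ} (j : Fin (N + 1))
    (σ : Equiv.Perm (Fin N)) :
    ewensW θ (Equiv.Perm.decomposeFin.symm (j, σ)) = insertionW θ N j * ewensW θ σ := by
  simp only [ewensW, insertionW, cycleCount_decomposeFin_symm, Finset.prod_range_succ, pow_add]
  split_ifs <;> simp [div_eq_mul_inv] <;> ring

lemma sum_ewensW_succ {θ : ℝ} {N : ℕ} {E : Type*} [AddCommGroup E] [Module ℝ E]
    (g : Equiv.Perm (Fin (N + 1)) → E) :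
    ∑ σ, ewensW θ σ • g σ = ∑ j, insertionW θ N j •
      ∑ σ, ewensW θ σ • g (Equiv.Perm.decomposeFin.symm (j, σ)) := by
  rw [← Equiv.sum_comp Equiv.Perm.decomposeFin.symm, Fintype.sum_prod_type]
  refine Finset.sum_congr rfl fun j _ => ?_
  rw [Finset.smul_sum]
  refine Finset.sum_congr rfl fun σ _ => ?_
  rw [ewensW_decomposeFin_symm, mul_smul]

lemma sum_insertionW {θ : ℝ} (hθ : 0 < θ) (N : ℕ) : ∑ j, insertionW θ N j = 1 := by
  rw [Fin.sum_univ_succ]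
  simp only [insertionW, Fin.succ_ne_zero, if_true, if_false, Finset.sum_const, Finset.card_univ,
    Fintype.card_fin, nsmul_eq_mul]
  have : θ + N ≠ 0 := by positivity
  field_simp

lemma insertionW_nonneg {θ : ℝ} (hθ : 0 < θ) (N : ℕ) (j : Fin (N + 1)) :
    0 ≤ insertionW θ N j := by
  unfold insertionW; split_ifs <;> positivity

lemma sum_ewensW {θ : ℝ} (hθ : 0 < θ) (N : ℕ) :
    ∑ σ : Equiv.Perm (Fin N), ewensW θ σ = 1 := by
  induction N with
  | zero =>
    rw [Fintype.sum_subsingleton _ 1]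
    simp [ewensW, cycleCount]
  | succ N ih =>
    have := sum_ewensW_succ (θ := θ) (N := N) (fun _ => (1 : ℝ))
    simp only [smul_eq_mul, mul_one, ih] at this
    rw [this, sum_insertionW hθ]

lemma sum_abs_insertionW_sub {θ : ℝ} (hθ : 0 < θ) (N : ℕ) :
    ∑ j, |insertionW θ N j - insertionW 1 N j| ≤ 2 * |θ - 1| * (1 / ((N : ℝ) + 1)) := by
  rw [Fin.sum_univ_succ]
  simp only [insertionW, Fin.succ_ne_zero, if_true, if_false, Finset.sum_const, Finset.card_univ,
    Fintype.card_fin, nsmul_eq_mul]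
  have h1 : (0 : ℝ) < θ + N := by positivity
  have h2 : (0 : ℝ) < 1 + N := by positivity
  have e1 : θ / (θ + N) - 1 / (1 + N) = N / ((θ + N) * (1 + N)) * (θ - 1) := by
    field_simp; ring
  have e2 : 1 / (θ + N) - 1 / (1 + N) = - (1 / ((θ + N) * (1 + N)) * (θ - 1)) := by
    field_simp; ring
  rw [e1, e2, abs_neg, abs_mul, abs_mul, abs_of_nonneg (by positivity : (0:ℝ) ≤ N / ((θ + N) * (1 + N))),
    abs_of_nonneg (by positivity : (0:ℝ) ≤ 1 / ((θ + N) * (1 + N)))]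
  have h3 : (N : ℝ) / ((θ + N) * (1 + N)) ≤ 1 / ((N : ℝ) + 1) := by
    rw [div_le_div_iff₀ (by positivity) (by positivity)]
    nlinarith [hθ, (Nat.cast_nonneg N : (0:ℝ) ≤ N)]
  calc _ = 2 * |θ - 1| * ((N : ℝ) / ((θ + N) * (1 + N))) := by ring
    _ ≤ _ := by gcongr

/-- Comparison of the Ewens and the uniform expectations of a function that varies little
under left multiplication by a transposition. -/
lemma norm_sum_ewensW_sub_le {θ : ℝ} (hθ : 0 < θ) {L : ℝ} (N : ℕ)
    (g : Equiv.Perm (Fin N) → ℂ) (hg : ∀ σ a b, ‖g (Equiv.swap a b * σ) - g σ‖ ≤ L) :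
    ‖∑ σ, ewensW θ σ • g σ - ∑ σ, ewensW 1 σ • g σ‖
      ≤ L * (2 * |θ - 1|) * ∑ k ∈ Finset.range N, 1 / ((k : ℝ) + 1) := by
  induction N with
  | zero =>
    rw [Fintype.sum_subsingleton _ 1, Fintype.sum_subsingleton _ 1]
    simp [ewensW, cycleCount]
  | succ N ih =>
    set D := fun (j : Fin (N+1)) (σ : Equiv.Perm (Fin N)) => Equiv.Perm.decomposeFin.symm (j, σ)
      with hD
    have hL : 0 ≤ L := (norm_nonneg _).trans (hg 1 0 0)
    have key : ∑ σ, ewensW θ σ • g σ - ∑ σ, ewensW 1 σ • g σ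
        = ∑ j, (insertionW θ N j - insertionW 1 N j) •
            ∑ σ, ewensW θ σ • (g (D j σ) - g (D 0 σ))
          + ∑ j, insertionW 1 N j •
            (∑ σ, ewensW θ σ • g (D j σ) - ∑ σ, ewensW 1 σ • g (D j σ)) := by
      rw [sum_ewensW_succ, sum_ewensW_succ]
      have h0 : ∑ j, (insertionW θ N j - insertionW 1 N j) • ∑ σ, ewensW θ σ • g (D 0 σ) = 0 := by
        rw [← Finset.sum_smul, Finset.sum_sub_distrib, sum_insertionW hθ,
          sum_insertionW one_pos, sub_self, zero_smul]
      simp only [smul_sub, Finset.sum_sub_distrib] at h0 ⊢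
      rw [h0]
      simp only [sub_smul, Finset.sum_sub_distrib]
      simp only [hD]
      ring
    rw [key]
    refine (norm_add_le _ _).trans ?_
    rw [Finset.sum_range_succ, mul_add, add_comm]
    refine add_le_add ?_ ?_
    · refine (norm_sum_le _ _).trans ?_
      calc _ ≤ ∑ j, insertionW 1 N j *
            (L * (2 * |θ - 1|) * ∑ k ∈ Finset.range N, 1 / ((k : ℝ) + 1)) := by
            refine Finset.sum_le_sum fun j _ => ?_
            rw [norm_smul, Real.norm_eq_abs, abs_of_nonneg (insertionW_nonneg one_pos _ _)]
            refine mul_le_mul_of_nonneg_left (ih _ fun σ a b => ?_)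
              (insertionW_nonneg one_pos _ _)
            have : D j (Equiv.swap a b * σ)
                = Equiv.swap (Equiv.swap 0 j a.succ) (Equiv.swap 0 j b.succ) * D j σ := by
              simp only [hD]
              rw [decomposeFin_symm_eq_swap_mul j, decomposeFin_symm_eq_swap_mul j σ,
                decomposeFin_symm_mul, decomposeFin_symm_zero_swap, ← mul_assoc, ← mul_assoc,
                Equiv.mul_swap_eq_swap_mul]
            rw [this]
            exact hg _ _ _
        _ = _ := by rw [← Finset.sum_mul, sum_insertionW one_pos, one_mul]
    · refine (norm_sum_le _ _).trans ?_
      calc _ ≤ ∑ j, |insertionW θ N j - insertionW 1 N j| * L := by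
            refine Finset.sum_le_sum fun j _ => ?_
            rw [norm_smul, Real.norm_eq_abs]
            refine mul_le_mul_of_nonneg_left ?_ (abs_nonneg _)
            refine (norm_sum_le _ _).trans ?_
            calc _ ≤ ∑ σ : Equiv.Perm (Fin N), ewensW θ σ * L := by
                  refine Finset.sum_le_sum fun σ _ => ?_
                  rw [norm_smul, Real.norm_eq_abs, abs_of_nonneg (ewensW_nonneg hθ _)]
                  refine mul_le_mul_of_nonneg_left ?_ (ewensW_nonneg hθ _)
                  have := hg (D 0 σ) 0 j
                  simp only [hD] at this ⊢
                  rwa [← decomposeFin_symm_eq_swap_mul] at this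
              _ = L := by rw [← Finset.sum_mul, sum_ewensW hθ, one_mul]
        _ ≤ _ := by
            rw [← Finset.sum_mul]
            have := mul_le_mul_of_nonneg_right (sum_abs_insertionW_sub hθ N) hL
            refine this.trans (le_of_eq ?_)
            ring

lemma ewensW_one {N : ℕ} (σ : Equiv.Perm (Fin N)) : ewensW 1 σ = 1 / (N.factorial : ℝ) := by
  rw [ewensW, one_pow, ← Finset.prod_range_add_one_eq_factorial]
  push_cast
  congr 1
  exact Finset.prod_congr rfl fun k _ => by ring

/-- Expectation of a complex function under the weights `w`. -/
def wexp {Ω : Type*} [Fintype Ω] (w : Ω → ℝ) (f : Ω → ℂ) : ℂ := ∑ ω, (w ω : ℂ) * f ω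

section wexp

variable {Ω : Type*} [Fintype Ω] {w : Ω → ℝ}

lemma norm_wexp_le (hw : ∀ ω, 0 ≤ w ω) (hw1 : ∑ ω, w ω = 1) {f : Ω → ℂ} {B : ℝ}
    (hf : ∀ ω, ‖f ω‖ ≤ B) : ‖wexp w f‖ ≤ B := by
  unfold wexp
  refine (norm_sum_le _ _).trans ?_
  calc _ ≤ ∑ ω, w ω * B := by
        refine Finset.sum_le_sum fun ω _ => ?_
        rw [norm_mul, Complex.norm_real, Real.norm_eq_abs, abs_of_nonneg (hw ω)]
        exact mul_le_mul_of_nonneg_left (hf ω) (hw ω)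
    _ = B := by rw [← Finset.sum_mul, hw1, one_mul]

lemma wexp_sub (f g : Ω → ℂ) : wexp w (fun ω => f ω - g ω) = wexp w f - wexp w g := by
  simp [wexp, mul_sub]

lemma wexp_const_mul (c : ℂ) (f : Ω → ℂ) : wexp w (fun ω => c * f ω) = c * wexp w f := by
  simp only [wexp, Finset.mul_sum]
  exact Finset.sum_congr rfl fun _ _ => by ring

lemma wexp_sum {ι : Type*} (s : Finset ι) (f : ι → Ω → ℂ) :
    wexp w (fun ω => ∑ i ∈ s, f i ω) = ∑ i ∈ s, wexp w (f i) := by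
  simp only [wexp, Finset.mul_sum]
  exact Finset.sum_comm

end wexp

lemma norm_exp_I_sub_one_sub_le (x : ℝ) :
    ‖Complex.exp (Complex.I * x) - 1 - Complex.I * x‖ ≤ 3 * x ^ 2 := by
  have hn : ‖Complex.I * (x : ℂ)‖ = |x| := by simp
  rcases le_total |x| 1 with h | h
  · have := Complex.norm_exp_sub_one_sub_id_le (x := Complex.I * x) (by rwa [hn])
    rw [hn, sq_abs] at this
    nlinarith [sq_nonneg x]
  · have h1 := Real.norm_exp_I_mul_ofReal_sub_one_le (x := x)
    have h2 := norm_sub_le (Complex.exp (Complex.I * x) - 1) (Complex.I * x)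
    rw [hn] at h2
    rw [Real.norm_eq_abs] at h1
    nlinarith [sq_abs x]

section DependencyGraph

variable {Ω ι : Type*} [Fintype Ω] [Fintype ι] [DecidableEq ι] {w : Ω → ℝ}

/-- Differential inequality for the characteristic function of a sum of bounded variables with
local dependence. -/
lemma norm_deriv_charFun_add_le (hw : ∀ ω, 0 ≤ w ω) (hw1 : ∑ ω, w ω = 1)
    (X : ι → Ω → ℝ) (hX : ∀ α ω, |X α ω| ≤ 1) (Nb : ι → Finset ι) (D : ℝ)
    (hD : ∀ α, ((Nb α).card : ℝ) ≤ D)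
    (h1 : ∀ α (t : ℝ), wexp w (fun ω => (X α ω : ℂ) *
      Complex.exp (Complex.I * (t * ∑ β ∈ (Nb α)ᶜ, X β ω : ℝ))) = 0)
    (h2 : ∀ α, ∀ β ∈ Nb α, ∀ t : ℝ, wexp w (fun ω => ((X α ω * X β ω : ℝ) : ℂ) *
      Complex.exp (Complex.I * (t * ∑ γ ∈ (Nb α ∪ Nb β)ᶜ, X γ ω : ℝ)))
      = wexp w (fun ω => ((X α ω * X β ω : ℝ) : ℂ)) *
        wexp w (fun ω => Complex.exp (Complex.I * (t * ∑ γ ∈ (Nb α ∪ Nb β)ᶜ, X γ ω : ℝ))))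
    (t : ℝ) :
    ‖wexp w (fun ω => Complex.I * (∑ α, X α ω : ℝ) *
        Complex.exp (Complex.I * (t * ∑ α, X α ω : ℝ)))
      + t * (∑ α, ∑ β ∈ Nb α, ∑ ω, w ω * (X α ω * X β ω) : ℝ) *
        wexp w (fun ω => Complex.exp (Complex.I * (t * ∑ α, X α ω : ℝ)))‖
      ≤ 7 * t ^ 2 * D ^ 2 * Fintype.card ι := by
  set S : Ω → ℝ := fun ω => ∑ α, X α ω with hS
  set e : ℝ → ℂ := fun x => Complex.exp (Complex.I * x) with he
  have hen : ∀ x, ‖e x‖ = 1 := fun x => by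
    simp only [he]; rw [mul_comm]; exact Complex.norm_exp_ofReal_mul_I x
  have hea : ∀ x y, e (x + y) = e x * e y := fun x y => by
    simp only [he]; rw [← Complex.exp_add]; push_cast; ring_nf
  have hR : ∀ (A : Finset ι) ω, |∑ β ∈ A, X β ω| ≤ A.card := fun A ω =>
    (Finset.abs_sum_le_sum_abs _ _).trans
      ((Finset.sum_le_card_nsmul _ _ 1 fun β _ => hX β ω).trans (by simp))
  have hsplit : ∀ (A : Finset ι) ω, S ω = ∑ β ∈ A, X β ω + ∑ β ∈ Aᶜ, X β ω := fun A ω =>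
    (Finset.sum_add_sum_compl A _).symm
  have hdiff : ∀ (A : Finset ι) ω,
      ‖e (t * ∑ β ∈ Aᶜ, X β ω) - e (t * S ω)‖ ≤ |t| * A.card := fun A ω => by
    rw [hsplit A ω, mul_add, hea]
    have : e (t * ∑ β ∈ Aᶜ, X β ω) - e (t * ∑ β ∈ A, X β ω) * e (t * ∑ β ∈ Aᶜ, X β ω)
        = - ((e (t * ∑ β ∈ A, X β ω) - 1) * e (t * ∑ β ∈ Aᶜ, X β ω)) := by ring
    rw [this, norm_neg, norm_mul, hen, mul_one]
    refine (Real.norm_exp_I_mul_ofReal_sub_one_le).trans ?_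
    rw [Real.norm_eq_abs, abs_mul]
    exact mul_le_mul_of_nonneg_left (hR _ _) (abs_nonneg _)
  set φ := wexp w (fun ω => e (t * S ω)) with hφ
  have hprod : ∀ α β ω, ‖((X α ω * X β ω : ℝ) : ℂ)‖ ≤ 1 := fun α β ω => by
    rw [Complex.norm_real, Real.norm_eq_abs, abs_mul]
    exact mul_le_one₀ (hX _ _) (abs_nonneg _) (hX _ _)
  have hpair : ∀ α, ∀ β ∈ Nb α,
      ‖wexp w (fun ω => ((X α ω * X β ω : ℝ) : ℂ) * e (t * S ω))
        - wexp w (fun ω => ((X α ω * X β ω : ℝ) : ℂ)) * φ‖ ≤ 4 * |t| * D := by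
    intro α β hβ
    set A := Nb α ∪ Nb β with hA
    have hAc : (A.card : ℝ) ≤ 2 * D := by
      have : (A.card : ℝ) ≤ (Nb α).card + (Nb β).card := by
        exact_mod_cast Finset.card_union_le _ _
      linarith [hD α, hD β]
    have hb : |t| * A.card ≤ 2 * |t| * D := by nlinarith [abs_nonneg t]
    have a1 : ‖wexp w (fun ω => ((X α ω * X β ω : ℝ) : ℂ) * e (t * S ω))
        - wexp w (fun ω => ((X α ω * X β ω : ℝ) : ℂ) * e (t * ∑ γ ∈ Aᶜ, X γ ω))‖
        ≤ 2 * |t| * D := by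
      rw [← wexp_sub]
      refine norm_wexp_le hw hw1 fun ω => ?_
      rw [← mul_sub, norm_mul, norm_sub_rev]
      calc _ ≤ 1 * (|t| * A.card) :=
            mul_le_mul (hprod _ _ _) (hdiff _ _) (norm_nonneg _) zero_le_one
        _ ≤ _ := by linarith
    have a2 : ‖wexp w (fun ω => ((X α ω * X β ω : ℝ) : ℂ)) *
        (wexp w (fun ω => e (t * ∑ γ ∈ Aᶜ, X γ ω)) - φ)‖ ≤ 2 * |t| * D := by
      rw [norm_mul, hφ, ← wexp_sub]
      calc _ ≤ 1 * (|t| * A.card) :=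
            mul_le_mul (norm_wexp_le hw hw1 (hprod α β)) (norm_wexp_le hw hw1 (hdiff A))
              (norm_nonneg _) zero_le_one
        _ ≤ _ := by linarith
    have a3 := h2 α β hβ t
    have : wexp w (fun ω => ((X α ω * X β ω : ℝ) : ℂ) * e (t * S ω))
        - wexp w (fun ω => ((X α ω * X β ω : ℝ) : ℂ)) * φ
        = (wexp w (fun ω => ((X α ω * X β ω : ℝ) : ℂ) * e (t * S ω))
          - wexp w (fun ω => ((X α ω * X β ω : ℝ) : ℂ) * e (t * ∑ γ ∈ Aᶜ, X γ ω)))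
        + wexp w (fun ω => ((X α ω * X β ω : ℝ) : ℂ)) *
        (wexp w (fun ω => e (t * ∑ γ ∈ Aᶜ, X γ ω)) - φ) := by
      simp only [he] at a3 ⊢
      rw [a3]; ring
    rw [this]
    refine (norm_add_le _ _).trans ?_
    linarith
  have hsingle : ∀ α, ‖wexp w (fun ω => (X α ω : ℂ) * e (t * S ω))
      - Complex.I * t * ∑ β ∈ Nb α, wexp w (fun ω => ((X α ω * X β ω : ℝ) : ℂ) * e (t * S ω))‖
      ≤ 3 * t ^ 2 * D ^ 2 := by
    intro α
    have : wexp w (fun ω => (X α ω : ℂ) * e (t * S ω))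
      - Complex.I * t * ∑ β ∈ Nb α, wexp w (fun ω => ((X α ω * X β ω : ℝ) : ℂ) * e (t * S ω))
      = wexp w (fun ω => - ((X α ω : ℂ) * e (t * S ω) * (e (-(t * ∑ β ∈ Nb α, X β ω)) - 1
        - Complex.I * (-(t * ∑ β ∈ Nb α, X β ω) : ℝ)))) := by
      rw [← wexp_sum, ← wexp_const_mul]
      have h0 : wexp w (fun ω => (X α ω : ℂ) * e (t * S ω))
        = wexp w (fun ω => (X α ω : ℂ) * e (t * S ω))
          - wexp w (fun ω => (X α ω : ℂ) * e (t * ∑ β ∈ (Nb α)ᶜ, X β ω)) := by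
        have := h1 α t
        simp only [he] at this ⊢
        rw [this, sub_zero]
      rw [h0, ← wexp_sub, ← wexp_sub]
      congr 1
      ext ω
      have h3 : e (t * ∑ β ∈ (Nb α)ᶜ, X β ω) = e (t * S ω) * e (-(t * ∑ β ∈ Nb α, X β ω)) := by
        rw [← hea, hsplit (Nb α) ω]; congr 1; ring
      rw [h3]
      have h4 : ∑ β ∈ Nb α, ((X α ω * X β ω : ℝ) : ℂ) * e (t * S ω)
          = (X α ω : ℂ) * e (t * S ω) * ((∑ β ∈ Nb α, X β ω : ℝ) : ℂ) := by
        generalize e (t * S ω) = z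
        push_cast
        rw [Finset.mul_sum]
        exact Finset.sum_congr rfl fun _ _ => by ring
      rw [h4]
      push_cast
      ring
    rw [this]
    refine norm_wexp_le hw hw1 fun ω => ?_
    rw [norm_neg, norm_mul, norm_mul, hen, mul_one, Complex.norm_real, Real.norm_eq_abs]
    have b1 := norm_exp_I_sub_one_sub_le (-(t * ∑ β ∈ Nb α, X β ω))
    have b2 : (-(t * ∑ β ∈ Nb α, X β ω)) ^ 2 ≤ t ^ 2 * D ^ 2 := by
      rw [neg_sq, mul_pow]
      refine mul_le_mul_of_nonneg_left ?_ (sq_nonneg t)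
      rw [← sq_abs]
      exact pow_le_pow_left₀ (abs_nonneg _) ((hR _ _).trans (hD α)) 2
    calc _ ≤ 1 * (3 * (-(t * ∑ β ∈ Nb α, X β ω)) ^ 2) :=
          mul_le_mul (hX _ _) b1 (norm_nonneg _) zero_le_one
      _ ≤ _ := by linarith
  have hcov : ∀ α β, wexp w (fun ω => ((X α ω * X β ω : ℝ) : ℂ))
      = ((∑ ω, w ω * (X α ω * X β ω) : ℝ) : ℂ) := fun α β => by
    simp [wexp]
  have htot : wexp w (fun ω => Complex.I * (S ω : ℂ) * e (t * S ω))
      = Complex.I * ∑ α, wexp w (fun ω => (X α ω : ℂ) * e (t * S ω)) := by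
    rw [← wexp_sum, ← wexp_const_mul]
    congr 1
    ext ω
    simp only [hS]
    push_cast
    rw [← Finset.sum_mul]
    ring
  have hfin : wexp w (fun ω => Complex.I * (S ω : ℂ) * e (t * S ω))
      + t * ((∑ α, ∑ β ∈ Nb α, ∑ ω, w ω * (X α ω * X β ω) : ℝ) : ℂ) * φ
      = ∑ α, Complex.I * ((wexp w (fun ω => (X α ω : ℂ) * e (t * S ω))
          - Complex.I * t * ∑ β ∈ Nb α, wexp w (fun ω => ((X α ω * X β ω : ℝ) : ℂ) * e (t * S ω)))
        + Complex.I * t * ∑ β ∈ Nb α, (wexp w (fun ω => ((X α ω * X β ω : ℝ) : ℂ) * e (t * S ω))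
          - wexp w (fun ω => ((X α ω * X β ω : ℝ) : ℂ)) * φ)) := by
    have : ((∑ α, ∑ β ∈ Nb α, ∑ ω, w ω * (X α ω * X β ω) : ℝ) : ℂ)
        = ∑ α, ∑ β ∈ Nb α, wexp w (fun ω => ((X α ω * X β ω : ℝ) : ℂ)) := by
      simp only [hcov]; push_cast; rfl
    rw [htot, this, Finset.mul_sum, Finset.mul_sum, Finset.sum_mul, ← Finset.sum_add_distrib]
    refine Finset.sum_congr rfl fun α _ => ?_
    rw [Finset.sum_sub_distrib, ← Finset.sum_mul]
    linear_combination ((t : ℂ) * (∑ β ∈ Nb α, wexp w (fun ω => ((X α ω * X β ω : ℝ) : ℂ))) * φ)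
      * Complex.I_sq
  rw [hfin]
  refine (norm_sum_le _ _).trans ?_
  calc _ ≤ ∑ α : ι, 7 * t ^ 2 * D ^ 2 := by
        refine Finset.sum_le_sum fun α _ => ?_
        rw [norm_mul, Complex.norm_I, one_mul]
        refine (norm_add_le _ _).trans ?_
        have c1 := hsingle α
        have c2 : ‖Complex.I * t * ∑ β ∈ Nb α,
            (wexp w (fun ω => ((X α ω * X β ω : ℝ) : ℂ) * e (t * S ω))
              - wexp w (fun ω => ((X α ω * X β ω : ℝ) : ℂ)) * φ)‖ ≤ |t| * (D * (4 * |t| * D)) := by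
          rw [norm_mul, norm_mul, Complex.norm_I, one_mul, Complex.norm_real, Real.norm_eq_abs]
          refine mul_le_mul_of_nonneg_left ?_ (abs_nonneg _)
          refine (norm_sum_le _ _).trans ?_
          refine (Finset.sum_le_card_nsmul _ _ _ (hpair α)).trans ?_
          rw [nsmul_eq_mul]
          have hD0 : 0 ≤ D := (Nat.cast_nonneg _).trans (hD α)
          exact mul_le_mul_of_nonneg_right (hD α) (by positivity)
        have c3 : |t| * (D * (4 * |t| * D)) = 4 * t ^ 2 * D ^ 2 := by
          rw [← sq_abs t]; ring
        linarith
    _ = _ := by simp; ring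

/-- Quantitative normal approximation of the characteristic function of a sum of bounded
variables with local dependence. -/
lemma norm_charFun_sub_gaussian_le (hw : ∀ ω, 0 ≤ w ω) (hw1 : ∑ ω, w ω = 1)
    (X : ι → Ω → ℝ) (hX : ∀ α ω, |X α ω| ≤ 1) (Nb : ι → Finset ι) (D : ℝ)
    (hD : ∀ α, ((Nb α).card : ℝ) ≤ D)
    (h1 : ∀ α (t : ℝ), wexp w (fun ω => (X α ω : ℂ) *
      Complex.exp (Complex.I * (t * ∑ β ∈ (Nb α)ᶜ, X β ω : ℝ))) = 0)
    (h2 : ∀ α, ∀ β ∈ Nb α, ∀ t : ℝ, wexp w (fun ω => ((X α ω * X β ω : ℝ) : ℂ) *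
      Complex.exp (Complex.I * (t * ∑ γ ∈ (Nb α ∪ Nb β)ᶜ, X γ ω : ℝ)))
      = wexp w (fun ω => ((X α ω * X β ω : ℝ) : ℂ)) *
        wexp w (fun ω => Complex.exp (Complex.I * (t * ∑ γ ∈ (Nb α ∪ Nb β)ᶜ, X γ ω : ℝ))))
    {v : ℝ} (hv : v = ∑ α, ∑ β ∈ Nb α, ∑ ω, w ω * (X α ω * X β ω)) (hv0 : 0 ≤ v) (T : ℝ) :
    ‖wexp w (fun ω => Complex.exp (Complex.I * (T * ∑ α, X α ω : ℝ)))
      - Complex.exp (-(v * T ^ 2 / 2 : ℝ))‖ ≤ 7 * |T| ^ 3 * D ^ 2 * Fintype.card ι := by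
  set φ : ℝ → ℂ := fun t => wexp w (fun ω => Complex.exp (Complex.I * (t * ∑ α, X α ω : ℝ)))
    with hφ
  set φ' : ℝ → ℂ := fun t => wexp w (fun ω => Complex.I * (∑ α, X α ω : ℝ) *
        Complex.exp (Complex.I * (t * ∑ α, X α ω : ℝ))) with hφ'
  have hder : ∀ t, HasDerivAt φ (φ' t) t := by
    intro t
    simp only [hφ, hφ', wexp]
    refine HasDerivAt.fun_sum fun ω _ => HasDerivAt.const_mul _ ?_
    set s : ℝ := ∑ α, X α ω
    have : HasDerivAt (fun t : ℝ => Complex.I * ((t * s : ℝ) : ℂ)) (Complex.I * (s : ℂ)) t := by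
      have h := ((hasDerivAt_id t).mul_const s).ofReal_comp
      simpa using h.const_mul Complex.I
    have h := this.cexp
    rw [mul_comm] at h
    exact h
  have hder2 : ∀ t : ℝ, HasDerivAt (fun t : ℝ => Complex.exp ((v * t ^ 2 / 2 : ℝ) : ℂ))
      (Complex.exp ((v * t ^ 2 / 2 : ℝ) : ℂ) * ((v * t : ℝ) : ℂ)) t := by
    intro t
    have : HasDerivAt (fun t : ℝ => v * t ^ 2 / 2) (v * t) t := by
      have := (((hasDerivAt_id t).pow 2).const_mul v).div_const 2
      convert! this using 1
      simp; ring
    exact this.ofReal_comp.cexp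
  have hψ : ∀ t, HasDerivAt (fun t : ℝ => φ t * Complex.exp ((v * t ^ 2 / 2 : ℝ) : ℂ))
      ((φ' t + t * v * φ t) * Complex.exp ((v * t ^ 2 / 2 : ℝ) : ℂ)) t := by
    intro t
    refine ((hder t).mul (hder2 t)).congr_deriv ?_
    push_cast; ring
  have hexpn : ∀ x : ℝ, ‖Complex.exp (x : ℂ)‖ = Real.exp x := fun x => by
    rw [Complex.norm_exp]; simp
  have hbound : ∀ t ∈ Set.uIcc 0 T,
      ‖(φ' t + t * v * φ t) * Complex.exp ((v * t ^ 2 / 2 : ℝ) : ℂ)‖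
        ≤ 7 * T ^ 2 * D ^ 2 * Fintype.card ι * Real.exp (v * T ^ 2 / 2) := by
    intro t ht
    have ht2 : t ^ 2 ≤ T ^ 2 := by
      rw [← sq_abs t, ← sq_abs T]
      refine pow_le_pow_left₀ (abs_nonneg _) ?_ 2
      have := Set.abs_sub_left_of_mem_uIcc ht
      simpa using this
    rw [norm_mul, hexpn]
    refine mul_le_mul ?_ ?_ (Real.exp_nonneg _) (by positivity)
    · have := norm_deriv_charFun_add_le hw hw1 X hX Nb D hD h1 h2 t
      rw [← hv] at this
      refine this.trans ?_
      gcongr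
    · gcongr
  have hmv := (convex_uIcc (0 : ℝ) T).norm_image_sub_le_of_norm_hasDerivWithin_le
    (fun t ht => (hψ t).hasDerivWithinAt) hbound Set.left_mem_uIcc Set.right_mem_uIcc
  have hφ0 : φ 0 = 1 := by
    simp only [hφ, wexp]
    simp [← Complex.ofReal_sum, hw1]
  rw [hφ0] at hmv
  simp only [ne_eq, OfNat.ofNat_ne_zero, not_false_eq_true, zero_pow, mul_zero, zero_div,
    Complex.ofReal_zero, Complex.exp_zero, mul_one, sub_zero, Real.norm_eq_abs] at hmv
  have hfac : φ T - Complex.exp (-(v * T ^ 2 / 2 : ℝ))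
      = (φ T * Complex.exp ((v * T ^ 2 / 2 : ℝ) : ℂ) - 1) * Complex.exp (-(v * T ^ 2 / 2 : ℝ)) := by
    rw [sub_mul, mul_assoc, ← Complex.exp_add]
    simp
  show ‖φ T - _‖ ≤ _
  rw [hfac, norm_mul]
  have hn2 : ‖Complex.exp (-(v * T ^ 2 / 2 : ℝ))‖ = Real.exp (-(v * T ^ 2 / 2)) := by
    rw [← hexpn]; push_cast; rfl
  rw [hn2]
  calc _ ≤ (7 * T ^ 2 * D ^ 2 * Fintype.card ι * Real.exp (v * T ^ 2 / 2) * |T|)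
        * Real.exp (-(v * T ^ 2 / 2)) := by gcongr
    _ = 7 * T ^ 2 * D ^ 2 * Fintype.card ι * |T|
        * (Real.exp (v * T ^ 2 / 2) * Real.exp (-(v * T ^ 2 / 2))) := by ring
    _ = _ := by
      rw [← Real.exp_add, add_neg_cancel, Real.exp_zero, ← sq_abs T]; ring

end DependencyGraph

section Patterns

open Equiv Equiv.Perm

lemma perm_eq_of_lt_iff_lt {k : ℕ} {π π' : Perm (Fin k)} (h : ∀ i j, π i < π j ↔ π' i < π' j) :
    π = π' := by
  have h1 : StrictMono (fun i => π' (π.symm i)) := fun i j hij => by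
    rw [← h]; simpa using hij
  have h2 := (h1.range_inj (strictMono_id (α := Fin k))).1 (by
    rw [Set.range_id]; exact (π'.surjective.comp π.symm.surjective).range_eq)
  ext i
  have := congrFun h2 (π i)
  simp at this
  rw [this]

/-- The standardization of the restriction of `σ` along the embedding `γ`. -/
def restrictPattern {k N : ℕ} (γ : Fin k ↪ Fin N) (σ : Perm (Fin N)) : Perm (Fin k) :=
  (Tuple.sort (σ ∘ γ))⁻¹

lemma restrictPattern_lt_iff {k N : ℕ} (γ : Fin k ↪ Fin N) (σ : Perm (Fin N)) (i j : Fin k) :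
    restrictPattern γ σ i < restrictPattern γ σ j ↔ σ (γ i) < σ (γ j) := by
  have hm : StrictMono ((σ ∘ γ) ∘ Tuple.sort (σ ∘ γ)) :=
    (Tuple.monotone_sort _).strictMono_of_injective
      ((σ.injective.comp γ.injective).comp (Tuple.sort _).injective)
  have := hm.lt_iff_lt (a := restrictPattern γ σ i) (b := restrictPattern γ σ j)
  simpa [restrictPattern] using this.symm

lemma restrictPattern_mul {k N : ℕ} (γ : Fin k ↪ Fin N) (σ : Perm (Fin N)) (ρ : Perm (Fin k)) :
    restrictPattern γ (σ * ρ.viaFintypeEmbedding γ) = restrictPattern γ σ * ρ := by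
  apply perm_eq_of_lt_iff_lt
  intro i j
  rw [restrictPattern_lt_iff]
  simp [viaFintypeEmbedding_apply_image, restrictPattern_lt_iff]

lemma wexp_uniform_comp_mul {N : ℕ} (f : Perm (Fin N) → ℂ) (π : Perm (Fin N)) :
    wexp (ewensW 1) (fun σ => f (σ * π)) = wexp (ewensW 1) f := by
  simp only [wexp, ewensW_one]
  exact Equiv.sum_comp (Equiv.mulRight π) (fun σ => ((1 / (N.factorial : ℝ) : ℝ) : ℂ) * f σ)

/-- Under the uniform measure the standardization along `γ` is uniform, and independent of any
function invariant under permuting the positions in the range of `γ`. -/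
lemma wexp_uniform_restrictPattern_mul {k N : ℕ} (γ : Fin k ↪ Fin N) (F : Perm (Fin k) → ℂ)
    (G : Perm (Fin N) → ℂ) (hG : ∀ σ (ρ : Perm (Fin k)), G (σ * ρ.viaFintypeEmbedding γ) = G σ) :
    wexp (ewensW 1) (fun σ => F (restrictPattern γ σ) * G σ)
      = wexp (ewensW 1) F * wexp (ewensW 1) G := by
  have h1 : ∀ ρ : Perm (Fin k), wexp (ewensW 1) (fun σ => F (restrictPattern γ σ * ρ) * G σ)
      = wexp (ewensW 1) (fun σ => F (restrictPattern γ σ) * G σ) := fun ρ => by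
    rw [← wexp_uniform_comp_mul (fun σ => F (restrictPattern γ σ) * G σ) (ρ.viaFintypeEmbedding γ)]
    simp only [restrictPattern_mul, hG]
  have h2 : ∀ σ, ∑ ρ, F (restrictPattern γ σ * ρ) = ∑ ρ, F ρ := fun σ =>
    Equiv.sum_comp (Equiv.mulLeft (restrictPattern γ σ)) F
  have h3 : ∑ ρ : Perm (Fin k), wexp (ewensW 1) (fun σ => F (restrictPattern γ σ * ρ) * G σ)
      = (∑ ρ, F ρ) * wexp (ewensW 1) G := by
    rw [← wexp_sum, ← wexp_const_mul]
    congr 1; ext σ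
    rw [← Finset.sum_mul, h2]
  simp only [h1, Finset.sum_const, Finset.card_univ, Fintype.card_perm, Fintype.card_fin,
    nsmul_eq_mul] at h3
  have h4 : wexp (ewensW 1) F = (∑ ρ, F ρ) / (k.factorial : ℂ) := by
    simp [wexp, ewensW_one, Finset.mul_sum, div_eq_inv_mul]
  have hk : (k.factorial : ℂ) ≠ 0 := by exact_mod_cast k.factorial_ne_zero
  rw [h4, div_mul_eq_mul_div, ← h3]
  field_simp

lemma wexp_uniform_one (N : ℕ) : wexp (ewensW 1) (fun _ : Perm (Fin N) => (1 : ℂ)) = 1 := by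
  simp only [wexp, mul_one, ← Complex.ofReal_sum, sum_ewensW one_pos, Complex.ofReal_one]

lemma wexp_uniform_restrictPattern {k N : ℕ} (γ : Fin k ↪ Fin N) (F : Perm (Fin k) → ℂ) :
    wexp (ewensW 1) (fun σ => F (restrictPattern γ σ)) = wexp (ewensW 1) F := by
  have := wexp_uniform_restrictPattern_mul γ F (fun _ => 1) (fun _ _ => rfl)
  simpa [wexp_uniform_one] using this

/-- Indicator that `σ` has pattern `τ` along the tuple `α`. -/
def patInd {p N : ℕ} (τ : Perm (Fin p)) (α : Fin p → Fin N) (σ : Perm (Fin N)) : ℝ :=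
  if ∀ a b : Fin p, σ (α a) < σ (α b) ↔ τ a < τ b then 1 else 0

/-- Centered indicator that `σ` has pattern `τ` along the tuple `α`. -/
def cPatInd {p N : ℕ} (τ : Perm (Fin p)) (α : Fin p → Fin N) (σ : Perm (Fin N)) : ℝ :=
  patInd τ α σ - 1 / (p.factorial : ℝ)

lemma abs_cPatInd_le {p N : ℕ} (τ : Perm (Fin p)) (α : Fin p → Fin N) (σ : Perm (Fin N)) :
    |cPatInd τ α σ| ≤ 1 := by
  have h1 : (0 : ℝ) ≤ 1 / (p.factorial : ℝ) := by positivity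
  have h2 : 1 / (p.factorial : ℝ) ≤ 1 := by
    rw [div_le_one (by positivity)]; exact_mod_cast p.factorial_pos
  unfold cPatInd patInd
  split_ifs <;> rw [abs_le] <;> constructor <;> linarith

lemma cPatInd_comp {p k N : ℕ} (τ : Perm (Fin p)) (γ : Fin k ↪ Fin N) (a : Fin p → Fin k)
    (σ : Perm (Fin N)) : cPatInd τ (γ ∘ a) σ = cPatInd τ a (restrictPattern γ σ) := by
  simp [cPatInd, patInd, restrictPattern_lt_iff]

lemma cPatInd_mul_viaFintypeEmbedding {p k N : ℕ} (τ : Perm (Fin p)) (γ : Fin k ↪ Fin N)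
    (α : Fin p → Fin N) (h : ∀ i, α i ∉ Set.range γ) (σ : Perm (Fin N)) (ρ : Perm (Fin k)) :
    cPatInd τ α (σ * ρ.viaFintypeEmbedding γ) = cPatInd τ α σ := by
  simp [cPatInd, patInd, viaFintypeEmbedding_apply_notMem_range _ _ (h _)]

lemma wexp_uniform_cPatInd_id {p : ℕ} (τ : Perm (Fin p)) :
    wexp (ewensW 1) (fun σ => (cPatInd τ id σ : ℂ)) = 0 := by
  have h : ∀ σ : Perm (Fin p), patInd τ id σ = if σ = τ then 1 else 0 := fun σ => by
    unfold patInd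
    refine if_congr ⟨fun h => perm_eq_of_lt_iff_lt fun i j => h i j, fun h => ?_⟩ rfl rfl
    subst h; simp
  have h2 : ∑ σ : Perm (Fin p), ewensW 1 σ * cPatInd τ id σ = 0 := by
    simp only [cPatInd, h, mul_sub, Finset.sum_sub_distrib, ← Finset.sum_mul,
      sum_ewensW one_pos]
    simp [ewensW_one]
  simp only [wexp, ← Complex.ofReal_mul, ← Complex.ofReal_sum, h2, Complex.ofReal_zero]

/-- Two tuples with values in `Fin N` factor through a common increasing embedding whose range is
the union of their ranges. -/
lemma exists_common_embedding {p N : ℕ} (α β : Fin p → Fin N) :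
    ∃ (γ : Fin ((univ.image α ∪ univ.image β).card) ↪o Fin N) (a b : _),
      α = γ ∘ a ∧ β = γ ∘ b ∧ Set.range γ = Set.range α ∪ Set.range β := by
  set S := univ.image α ∪ univ.image β with hS
  have hr : Set.range (S.orderEmbOfFin rfl) = Set.range α ∪ Set.range β := by
    rw [Finset.range_orderEmbOfFin]; simp [hS]
  have ha : ∀ i, ∃ x, S.orderEmbOfFin rfl x = α i := fun i => by
    have : α i ∈ Set.range (S.orderEmbOfFin rfl) := by rw [hr]; left; exact ⟨i, rfl⟩
    exact this
  have hb : ∀ i, ∃ x, S.orderEmbOfFin rfl x = β i := fun i => by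
    have : β i ∈ Set.range (S.orderEmbOfFin rfl) := by rw [hr]; right; exact ⟨i, rfl⟩
    exact this
  choose a ha using ha
  choose b hb using hb
  exact ⟨S.orderEmbOfFin rfl, a, b, funext fun i => (ha i).symm, funext fun i => (hb i).symm, hr⟩

/-- The members of a family of tuples which meet a given one. -/
def nbhd {p N : ℕ} (T : Finset (Fin p → Fin N)) (α : T) : Finset T :=
  univ.filter fun β => ∃ i j, β.1 j = α.1 i

lemma notMem_range_of_notMem_nbhd {p N : ℕ} {T : Finset (Fin p → Fin N)} {α β : T}
    (h : β ∉ nbhd T α) (i : Fin p) : β.1 i ∉ Set.range α.1 := by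
  rintro ⟨j, hj⟩
  exact h (by simp only [nbhd, Finset.mem_filter, Finset.mem_univ, true_and]; exact ⟨j, i, hj.symm⟩)

/-- Exponential of a sum of centered indicators. -/
def expSum {p N : ℕ} (τ : Perm (Fin p)) {T : Finset (Fin p → Fin N)} (A : Finset T) (t : ℝ)
    (σ : Perm (Fin N)) : ℂ :=
  Complex.exp (Complex.I * (t * ∑ β ∈ A, cPatInd τ β.1 σ : ℝ))

lemma expSum_mul_viaFintypeEmbedding {p k N : ℕ} (τ : Perm (Fin p)) {T : Finset (Fin p → Fin N)}
    (A : Finset T) (t : ℝ) (γ : Fin k ↪ Fin N) (h : ∀ β ∈ A, ∀ i, β.1 i ∉ Set.range γ)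
    (σ : Perm (Fin N)) (ρ : Perm (Fin k)) :
    expSum τ A t (σ * ρ.viaFintypeEmbedding γ) = expSum τ A t σ := by
  unfold expSum
  rw [Finset.sum_congr rfl fun β hβ => cPatInd_mul_viaFintypeEmbedding τ γ β.1 (h β hβ) σ ρ]

lemma wexp_cPatInd_mul_expSum {p N : ℕ} (τ : Perm (Fin p)) {T : Finset (Fin p → Fin N)}
    (hT : ∀ α ∈ T, StrictMono α) (α : T) (t : ℝ) :
    wexp (ewensW 1) (fun σ => (cPatInd τ α.1 σ : ℂ) * expSum τ (nbhd T α)ᶜ t σ) = 0 := by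
  have h := wexp_uniform_restrictPattern_mul ⟨α.1, (hT _ α.2).injective⟩
    (fun π => (cPatInd τ id π : ℂ)) (expSum τ (nbhd T α)ᶜ t)
    (fun σ ρ => expSum_mul_viaFintypeEmbedding τ _ t _ (fun β hβ i =>
      notMem_range_of_notMem_nbhd (Finset.mem_compl.1 hβ) i) σ ρ)
  simp only [← cPatInd_comp, wexp_uniform_cPatInd_id, zero_mul] at h
  exact h

lemma wexp_cPatInd_mul_cPatInd_mul_expSum {p N : ℕ} (τ : Perm (Fin p))
    {T : Finset (Fin p → Fin N)} (α β : T) (t : ℝ) :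
    wexp (ewensW 1) (fun σ => ((cPatInd τ α.1 σ * cPatInd τ β.1 σ : ℝ) : ℂ) *
        expSum τ (nbhd T α ∪ nbhd T β)ᶜ t σ)
      = wexp (ewensW 1) (fun σ => ((cPatInd τ α.1 σ * cPatInd τ β.1 σ : ℝ) : ℂ)) *
        wexp (ewensW 1) (expSum τ (nbhd T α ∪ nbhd T β)ᶜ t) := by
  obtain ⟨γ, a, b, ha, hb, hr⟩ := exists_common_embedding α.1 β.1
  have h := wexp_uniform_restrictPattern_mul γ.toEmbedding
    (fun π => ((cPatInd τ a π * cPatInd τ b π : ℝ) : ℂ)) (expSum τ (nbhd T α ∪ nbhd T β)ᶜ t)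
    (fun σ ρ => expSum_mul_viaFintypeEmbedding τ _ t _ (fun δ hδ i => by
      rw [Finset.mem_compl, Finset.mem_union, not_or] at hδ
      change δ.1 i ∉ Set.range γ
      rw [hr]
      rintro (h | h)
      · exact notMem_range_of_notMem_nbhd hδ.1 i h
      · exact notMem_range_of_notMem_nbhd hδ.2 i h) σ ρ)
  rw [← wexp_uniform_restrictPattern γ.toEmbedding
    (fun π => ((cPatInd τ a π * cPatInd τ b π : ℝ) : ℂ))] at h
  simp only [← cPatInd_comp] at h
  have ea : (γ.toEmbedding : _ → Fin N) ∘ a = α.1 := ha.symm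
  have eb : (γ.toEmbedding : _ → Fin N) ∘ b = β.1 := hb.symm
  rw [ea, eb] at h
  exact h

/-- The covariance of two centered indicators only depends on the relative position of the
tuples. -/
lemma sum_ewensW_cPatInd_comp {p k N : ℕ} (τ : Perm (Fin p)) (γ : Fin k ↪ Fin N)
    (a b : Fin p → Fin k) :
    ∑ σ, ewensW 1 σ * (cPatInd τ (γ ∘ a) σ * cPatInd τ (γ ∘ b) σ)
      = ∑ π, ewensW 1 π * (cPatInd τ a π * cPatInd τ b π) := by
  have h := wexp_uniform_restrictPattern γ (fun π => ((cPatInd τ a π * cPatInd τ b π : ℝ) : ℂ))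
  simp only [← cPatInd_comp, wexp] at h
  exact_mod_cast h

lemma sum_ewensW_cPatInd_of_notMem_nbhd {p N : ℕ} (τ : Perm (Fin p))
    {T : Finset (Fin p → Fin N)} (hT : ∀ α ∈ T, StrictMono α) {α β : T} (h : β ∉ nbhd T α) :
    ∑ σ, ewensW 1 σ * (cPatInd τ α.1 σ * cPatInd τ β.1 σ) = 0 := by
  have h := wexp_uniform_restrictPattern_mul ⟨α.1, (hT _ α.2).injective⟩
    (fun π => (cPatInd τ id π : ℂ)) (fun σ => (cPatInd τ β.1 σ : ℂ))
    (fun σ ρ => by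
      rw [cPatInd_mul_viaFintypeEmbedding]
      exact fun i => notMem_range_of_notMem_nbhd h i)
  simp only [← cPatInd_comp, wexp_uniform_cPatInd_id, zero_mul] at h
  simp only [wexp] at h
  exact_mod_cast h

/-- The second moment of the centered number of occurrences of `τ` along the tuples of `T`. -/
def patVar {p N : ℕ} (τ : Perm (Fin p)) (T : Finset (Fin p → Fin N)) : ℝ :=
  ∑ α ∈ T, ∑ β ∈ T, ∑ σ, ewensW 1 σ * (cPatInd τ α σ * cPatInd τ β σ)

lemma patVar_eq_sum_nbhd {p N : ℕ} (τ : Perm (Fin p))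
    {T : Finset (Fin p → Fin N)} (hT : ∀ α ∈ T, StrictMono α) :
    patVar τ T = ∑ α : T, ∑ β ∈ nbhd T α, ∑ σ, ewensW 1 σ * (cPatInd τ α.1 σ * cPatInd τ β.1 σ) := by
  unfold patVar
  rw [← Finset.sum_coe_sort T]
  refine Finset.sum_congr rfl fun α _ => ?_
  rw [← Finset.sum_coe_sort T]
  refine (Finset.sum_subset (Finset.subset_univ _) fun β _ hβ => ?_).symm
  exact sum_ewensW_cPatInd_of_notMem_nbhd τ hT hβ

lemma patVar_nonneg {p N : ℕ} (τ : Perm (Fin p)) (T : Finset (Fin p → Fin N)) :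
    0 ≤ patVar τ T := by
  have : patVar τ T = ∑ σ, ewensW 1 σ * (∑ α ∈ T, cPatInd τ α σ) ^ 2 := by
    unfold patVar
    rw [Finset.sum_congr rfl fun α _ => Finset.sum_comm, Finset.sum_comm]
    refine Finset.sum_congr rfl fun σ _ => ?_
    rw [sq, Finset.sum_mul_sum, Finset.mul_sum]
    exact Finset.sum_congr rfl fun α _ => by rw [Finset.mul_sum]
  rw [this]
  exact Finset.sum_nonneg fun σ _ => mul_nonneg (ewensW_nonneg one_pos σ) (sq_nonneg _)

lemma patVar_le {p N : ℕ} (τ : Perm (Fin p)) {T : Finset (Fin p → Fin N)}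
    (hT : ∀ α ∈ T, StrictMono α) {D : ℝ} (hD : ∀ α, ((nbhd T α).card : ℝ) ≤ D) :
    patVar τ T ≤ T.card * D := by
  rw [patVar_eq_sum_nbhd τ hT]
  calc _ ≤ ∑ α : T, D := by
        refine Finset.sum_le_sum fun α _ => le_trans ?_ (hD α)
        refine (Finset.sum_le_card_nsmul _ _ 1 fun β _ => ?_).trans (by simp)
        calc _ ≤ ∑ σ : Perm (Fin N), ewensW 1 σ * 1 := by
              refine Finset.sum_le_sum fun σ _ =>
                mul_le_mul_of_nonneg_left ?_ (ewensW_nonneg one_pos σ)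
              refine (le_abs_self _).trans ?_
              rw [abs_mul]
              exact mul_le_one₀ (abs_cPatInd_le _ _ _) (abs_nonneg _) (abs_cPatInd_le _ _ _)
          _ = 1 := by simp [sum_ewensW one_pos]
    _ = _ := by simp

lemma norm_wexp_uniform_sub_gaussian_le {p N : ℕ} (τ : Perm (Fin p))
    {T : Finset (Fin p → Fin N)} (hT : ∀ α ∈ T, StrictMono α) {D : ℝ}
    (hD : ∀ α, ((nbhd T α).card : ℝ) ≤ D) (t : ℝ) :
    ‖wexp (ewensW 1) (fun σ => Complex.exp (Complex.I * (t * ∑ α ∈ T, cPatInd τ α σ : ℝ)))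
      - Complex.exp (-(patVar τ T * t ^ 2 / 2 : ℝ))‖ ≤ 7 * |t| ^ 3 * D ^ 2 * T.card := by
  have h := norm_charFun_sub_gaussian_le (w := ewensW 1) (ewensW_nonneg one_pos)
    (sum_ewensW one_pos N) (fun (α : T) σ => cPatInd τ α.1 σ) (fun α σ => abs_cPatInd_le _ _ _)
    (nbhd T) D hD (fun α t => wexp_cPatInd_mul_expSum τ hT α t)
    (fun α β _ t => by
      have := wexp_cPatInd_mul_cPatInd_mul_expSum τ α β t
      convert! this) (patVar_eq_sum_nbhd τ hT)
    (patVar_nonneg τ T) t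
  simp only [Fintype.card_coe] at h
  have e : ∀ σ, ∑ α : T, cPatInd τ α.1 σ = ∑ α ∈ T, cPatInd τ α σ := fun σ =>
    Finset.sum_coe_sort T (fun α => cPatInd τ α σ)
  simpa only [e] using h

end Patterns

section Counting

/-- Increasing tuples satisfying the adjacency constraints `f (i + 1) = f i + 1` for `i ∈ Y`. -/
def admissible (k N : ℕ) (Y : Finset ℕ) : Finset (Fin k → Fin N) :=
  univ.filter fun f => StrictMono f ∧
    ∀ i (h : i + 1 < k), i ∈ Y → (f ⟨i + 1, h⟩ : ℕ) = f ⟨i, by omega⟩ + 1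

lemma card_filter_strictMono (b m : ℕ) :
    (univ.filter fun g : Fin b → Fin m => StrictMono g).card = m.choose b := by
  have : (powersetCard b (univ : Finset (Fin m))).card = m.choose b := by simp
  rw [← this]
  refine Finset.card_bij (fun g _ => univ.image g) ?_ ?_ ?_
  · intro g hg
    have hg : StrictMono g := (Finset.mem_filter.1 hg).2
    rw [Finset.mem_powersetCard]
    exact ⟨Finset.subset_univ _, by rw [Finset.card_image_of_injective _ hg.injective]; simp⟩
  · intro g hg g' hg' h
    have hg : StrictMono g := (Finset.mem_filter.1 hg).2
    have hg' : StrictMono g' := (Finset.mem_filter.1 hg').2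
    refine (hg.range_inj hg').1 ?_
    have := congrArg (fun s : Finset (Fin m) => (s : Set (Fin m))) h
    simpa using this
  · intro S hS
    rw [Finset.mem_powersetCard] at hS
    refine ⟨S.orderEmbOfFin hS.2, by simp [(S.orderEmbOfFin hS.2).strictMono], ?_⟩
    apply Finset.coe_injective
    simp

lemma count_mem_add_count_notMem (Y : Finset ℕ) (i : ℕ) :
    Nat.count (· ∈ Y) i + Nat.count (· ∉ Y) i = i := by
  induction i with
  | zero => simp
  | succ i ih =>
    rw [Nat.count_succ, Nat.count_succ]
    by_cases h : i ∈ Y <;> simp [h] <;> omega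

lemma count_mem_eq_card {Y : Finset ℕ} {k : ℕ} (hY : ∀ y ∈ Y, y + 1 < k) :
    Nat.count (· ∈ Y) k = Y.card := by
  rw [Nat.count_eq_card_filter_range]
  congr 1
  ext y
  simp only [Finset.mem_filter, Finset.mem_range, and_iff_right_iff_imp]
  intro h; have := hY y h; omega

lemma count_notMem_eq {Y : Finset ℕ} {k : ℕ} (hY : ∀ y ∈ Y, y + 1 < k) :
    Nat.count (· ∉ Y) k = k - Y.card := by
  have := count_mem_add_count_notMem Y k
  rw [count_mem_eq_card hY] at this
  omega

lemma count_notMem_lt {Y : Finset ℕ} {k : ℕ} (hY : ∀ y ∈ Y, y + 1 < k) {i : ℕ} (hi : i < k) :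
    Nat.count (· ∉ Y) i < k - Y.card := by
  rw [← count_notMem_eq hY]
  obtain ⟨m, rfl⟩ : ∃ m, k = m + 1 := ⟨k - 1, by omega⟩
  have hm : m ∉ Y := fun h => by have := hY m h; omega
  rw [Nat.count_succ, if_pos hm]
  have := Nat.count_monotone (· ∉ Y) (show i ≤ m by omega)
  omega

lemma strictMono_add_le {k N : ℕ} {f : Fin k → Fin N} (hf : StrictMono f) {i j : ℕ} (hij : i ≤ j)
    (hj : j < k) : (f ⟨i, by omega⟩ : ℕ) + j ≤ f ⟨j, hj⟩ + i := by
  induction j, hij using Nat.le_induction with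
  | base => rfl
  | succ j hij ih =>
    have h1 := ih (by omega)
    have h2 : (f ⟨j, by omega⟩ : ℕ) < f ⟨j + 1, hj⟩ := by
      have : f ⟨j, by omega⟩ < f ⟨j + 1, hj⟩ := hf (by simp)
      exact this
    omega

lemma admissible_add_eq {k N : ℕ} {Y : Finset ℕ} {f : Fin k → Fin N} (hf : f ∈ admissible k N Y)
    {i j : ℕ} (hi : i < k) (hj : j < k) (h : Nat.count (· ∉ Y) i = Nat.count (· ∉ Y) j) :
    (f ⟨i, hi⟩ : ℕ) + j = f ⟨j, hj⟩ + i := by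
  have hf2 := (Finset.mem_filter.1 hf).2.2
  have key : ∀ i j : ℕ, i ≤ j → ∀ (hi : i < k) (hj : j < k),
      Nat.count (· ∉ Y) i = Nat.count (· ∉ Y) j → (f ⟨i, hi⟩ : ℕ) + j = f ⟨j, hj⟩ + i := by
    intro i j hij
    induction j, hij using Nat.le_induction with
    | base => intros; rfl
    | succ j hij ih =>
      intro hi hj h
      have hmono := Nat.count_monotone (· ∉ Y) hij
      rw [Nat.count_succ] at h
      by_cases hjY : j ∈ Y
      · have h1 := ih hi (by omega) (by simpa [hjY] using h)
        have h2 := hf2 j hj hjY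
        omega
      · simp only [hjY, not_false_eq_true, if_true] at h
        omega
  rcases le_total i j with hij | hij
  · exact key i j hij hi hj h
  · exact (key j i hij hj hi h.symm).symm

/-- The last position of the `j`-th block. -/
def blockEnd (Y : Finset ℕ) (j : ℕ) : ℕ := Nat.nth (· ∉ Y) j

lemma count_blockEnd (Y : Finset ℕ) (j : ℕ) : Nat.count (· ∉ Y) (blockEnd Y j) = j :=
  Nat.count_nth_of_infinite (Y.finite_toSet.infinite_compl) j

lemma blockEnd_strictMono (Y : Finset ℕ) : StrictMono (blockEnd Y) :=
  Nat.nth_strictMono (Y.finite_toSet.infinite_compl)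

lemma blockEnd_lt {Y : Finset ℕ} {k : ℕ} (hY : ∀ y ∈ Y, y + 1 < k) {j : ℕ}
    (hj : j < k - Y.card) : blockEnd Y j < k := by
  rw [← count_notMem_eq hY] at hj
  exact Nat.nth_lt_of_lt_count hj

lemma card_admissible {k : ℕ} (N : ℕ) {Y : Finset ℕ} (hk : 0 < k) (hY : ∀ y ∈ Y, y + 1 < k) :
    (admissible k N Y).card = (N - Y.card).choose (k - Y.card) := by
  set r := Nat.count (· ∈ Y) with hr
  set s := Nat.count (· ∉ Y) with hs
  have hrs : ∀ i, r i + s i = i := count_mem_add_count_notMem Y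
  have hsm : Monotone s := Nat.count_monotone _
  have hrm : Monotone r := Nat.count_monotone _
  have hrk : r k = Y.card := count_mem_eq_card hY
  have hsk : ∀ i, i < k → s i < k - Y.card := fun i hi => count_notMem_lt hY hi
  rw [← card_filter_strictMono]
  symm
  refine Finset.card_bij (fun g _ i => ⟨g ⟨s i, hsk i i.2⟩ + r i, ?_⟩) ?_ ?_ ?_
  · have h1 := (g ⟨s i, hsk i i.2⟩).2
    have h2 := hrm i.2.le
    omega
  · intro g hg
    have hg : StrictMono g := (Finset.mem_filter.1 hg).2
    simp only [admissible, Finset.mem_filter, Finset.mem_univ, true_and]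
    refine ⟨fun i j hij => ?_, fun i hi hiY => ?_⟩
    · rw [Fin.lt_def]
      have hij' : (i : ℕ) < j := hij
      have h1 := hsm hij'.le
      have h2 := hrm hij'.le
      have h3 := hrs i
      have h4 := hrs j
      have h5 : g ⟨s i, hsk i i.2⟩ ≤ g ⟨s j, hsk j j.2⟩ := hg.monotone (by simpa using h1)
      have h5' : (g ⟨s i, hsk i i.2⟩ : ℕ) ≤ g ⟨s j, hsk j j.2⟩ := h5
      simp only
      rcases h1.lt_or_eq with h1 | h1
      · have h6 : g ⟨s i, hsk i i.2⟩ < g ⟨s j, hsk j j.2⟩ := hg (by simpa using h1)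
        have h6' : (g ⟨s i, hsk i i.2⟩ : ℕ) < g ⟨s j, hsk j j.2⟩ := h6
        omega
      · omega
    · have h1 : s (i + 1) = s i := by simp [hs, Nat.count_succ, hiY]
      have h2 : r (i + 1) = r i + 1 := by simp [hr, Nat.count_succ, hiY]
      simp only [h1, h2]
      omega
  · intro g _ g' _ h
    ext ⟨j, hj⟩
    have h1 := congrArg Fin.val (congrFun h ⟨blockEnd Y j, blockEnd_lt hY hj⟩)
    have h2 : s (blockEnd Y j) = j := count_blockEnd Y j
    simp only [h2] at h1
    omega
  · intro f hf
    have hfm : StrictMono f := (Finset.mem_filter.1 hf).2.1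
    have hbe : ∀ j : Fin (k - Y.card), blockEnd Y j < k := fun j => blockEnd_lt hY j.2
    have hse : ∀ j, s (blockEnd Y j) = j := count_blockEnd Y
    have hge : ∀ i (hi : i < k), i ≤ f ⟨i, hi⟩ := fun i hi => by
      have := strictMono_add_le hfm (Nat.zero_le i) hi
      omega
    refine ⟨fun j => ⟨f ⟨blockEnd Y j, hbe j⟩ - r (blockEnd Y j), ?_⟩, ?_, ?_⟩
    · have h1 := strictMono_add_le hfm (show blockEnd Y j ≤ k - 1 by have := hbe j; omega)
        (by omega)
      have h2 := (f ⟨k - 1, by omega⟩).2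
      have h3 := hrs (blockEnd Y j)
      have h4 := hse j
      have h5 := hge _ (hbe j)
      have h6 := j.2
      omega
    · simp only [Finset.mem_filter, Finset.mem_univ, true_and]
      intro j j' hjj
      rw [Fin.lt_def]
      have hjj' : (j : ℕ) < j' := hjj
      have h1 := strictMono_add_le hfm (blockEnd_strictMono Y hjj').le (hbe j')
      have h3 := hrs (blockEnd Y j)
      have h4 := hse j
      have h3' := hrs (blockEnd Y j')
      have h4' := hse j'
      have h5 := hge _ (hbe j)
      have h5' := hge _ (hbe j')
      simp only
      omega
    · ext i
      have hb : blockEnd Y (s i) < k := blockEnd_lt hY (hsk i i.2)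
      have h1 := admissible_add_eq hf i.2 hb (hse (s i)).symm
      have h3 := hrs (blockEnd Y (s i))
      have h4 := hse (s i)
      have h5 := hge _ hb
      have h6 := hrs i
      simp only [Fin.eta] at h1 ⊢
      omega

lemma card_admissible_filter_le {k N : ℕ} {Y : Finset ℕ} (hY : ∀ y ∈ Y, y + 1 < k)
    (i : Fin k) (v : Fin N) :
    ((admissible k N Y).filter fun f => f i = v).card ≤ N ^ (k - Y.card - 1) := by
  set c : Fin (k - Y.card) := ⟨Nat.count (· ∉ Y) i, count_notMem_lt hY i.2⟩ with hc
  have hcard : Fintype.card ({j : Fin (k - Y.card) // j ≠ c} → Fin N) = N ^ (k - Y.card - 1) := by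
    simp
  rw [← hcard, ← Finset.card_univ]
  refine Finset.card_le_card_of_injOn
    (fun f j => f ⟨blockEnd Y j.1, blockEnd_lt hY j.1.2⟩) (fun _ _ => Finset.mem_univ _) ?_
  intro f hf f' hf' h
  obtain ⟨hf, hfv⟩ := Finset.mem_filter.1 (Finset.mem_coe.1 hf)
  obtain ⟨hf', hfv'⟩ := Finset.mem_filter.1 (Finset.mem_coe.1 hf')
  ext x
  by_cases hx : Nat.count (· ∉ Y) x = Nat.count (· ∉ Y) i
  · have h1 := admissible_add_eq hf x.2 i.2 hx
    have h2 := admissible_add_eq hf' x.2 i.2 hx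
    simp only [Fin.eta, hfv, hfv'] at h1 h2
    omega
  · have hlt := count_notMem_lt hY x.2
    have h0 := congrFun h ⟨⟨Nat.count (· ∉ Y) x, hlt⟩, fun h => hx (by simpa [hc] using h)⟩
    have h0' := congrArg Fin.val h0
    have h1 := admissible_add_eq hf x.2 (blockEnd_lt hY hlt) (count_blockEnd Y _).symm
    have h2 := admissible_add_eq hf' x.2 (blockEnd_lt hY hlt) (count_blockEnd Y _).symm
    simp only [Fin.eta] at h0' h1 h2
    omega

lemma card_nbhd_admissible_le {k N : ℕ} {Y : Finset ℕ} (hY : ∀ y ∈ Y, y + 1 < k)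
    (α : admissible k N Y) :
    (nbhd (admissible k N Y) α).card ≤ k ^ 2 * N ^ (k - Y.card - 1) := by
  have h1 : (nbhd (admissible k N Y) α).image Subtype.val ⊆
      (univ : Finset (Fin k × Fin k)).biUnion fun ij =>
        (admissible k N Y).filter fun f => f ij.2 = α.1 ij.1 := by
    intro f hf
    obtain ⟨β, hβ, rfl⟩ := Finset.mem_image.1 hf
    simp only [nbhd, Finset.mem_filter, Finset.mem_univ, true_and] at hβ
    obtain ⟨i, j, hij⟩ := hβ
    simp only [Finset.mem_biUnion, Finset.mem_univ, true_and, Finset.mem_filter]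
    exact ⟨(i, j), β.2, hij⟩
  rw [← Finset.card_image_of_injective _ Subtype.val_injective]
  refine (Finset.card_le_card h1).trans ?_
  refine (Finset.card_biUnion_le_card_mul _ _ (N ^ (k - Y.card - 1)) fun ij _ =>
    card_admissible_filter_le hY _ _).trans ?_
  simp [sq]

lemma card_admissible_le {k N : ℕ} {Y : Finset ℕ} (hk : 0 < k) (hY : ∀ y ∈ Y, y + 1 < k) :
    (admissible k N Y).card ≤ N ^ (k - Y.card) := by
  rw [card_admissible N hk hY]
  exact (Nat.choose_le_pow _ _).trans (Nat.pow_le_pow_left (Nat.sub_le _ _) _)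

lemma choose_div_pow_bounds {q b N : ℕ} (hN : q + b ≤ N) (hN0 : 0 < N) :
    |((N - q).choose b : ℝ) / (N : ℝ) ^ b - 1 / (b.factorial : ℝ)| ≤ (b * (q + b) : ℝ) / N := by
  have hb : (0 : ℝ) < b.factorial := by positivity
  have hb1 : (1 : ℝ) ≤ b.factorial := by exact_mod_cast b.factorial_pos
  have hNr : (0 : ℝ) < N := by exact_mod_cast hN0
  have hdesc : ((N - q).choose b : ℝ) = ((N - q).descFactorial b : ℝ) / b.factorial := by
    rw [Nat.descFactorial_eq_factorial_mul_choose]; push_cast; field_simp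
  have hup : ((N - q).descFactorial b : ℝ) ≤ (N : ℝ) ^ b := by
    exact_mod_cast (Nat.descFactorial_le_pow _ _).trans (Nat.pow_le_pow_left (Nat.sub_le _ _) _)
  have hlo : (1 - (b * (q + b) : ℝ) / N) * (N : ℝ) ^ b ≤ ((N - q).descFactorial b : ℝ) := by
    have h1 : ((N - q + 1 - b : ℕ) : ℝ) ^ b ≤ ((N - q).descFactorial b : ℝ) := by
      exact_mod_cast Nat.pow_sub_le_descFactorial (N - q) b
    have h2 : (N : ℝ) * (1 + -((q + b : ℝ) / N)) ≤ ((N - q + 1 - b : ℕ) : ℝ) := by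
      have : N ≤ (N - q + 1 - b) + (q + b) := by omega
      have : (N : ℝ) ≤ ((N - q + 1 - b : ℕ) : ℝ) + (q + b) := by exact_mod_cast this
      have e : (N : ℝ) * (1 + -((q + b : ℝ) / N)) = N - (q + b) := by field_simp; ring
      rw [e]; linarith
    have h3 : (q + b : ℝ) / N ≤ 1 := by
      rw [div_le_one hNr]; exact_mod_cast hN
    have h4 := one_add_mul_le_pow (a := -((q + b : ℝ) / N)) (by linarith) b
    calc _ = (1 + b * (-((q + b : ℝ) / N))) * (N : ℝ) ^ b := by ring
      _ ≤ (1 + -((q + b : ℝ) / N)) ^ b * (N : ℝ) ^ b := by gcongr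
      _ = ((N : ℝ) * (1 + -((q + b : ℝ) / N))) ^ b := by rw [mul_pow]; ring
      _ ≤ ((N - q + 1 - b : ℕ) : ℝ) ^ b := by
          refine pow_le_pow_left₀ ?_ h2 b
          exact mul_nonneg hNr.le (by linarith)
      _ ≤ _ := h1
  have hP : (0 : ℝ) < (N : ℝ) ^ b := by positivity
  have hx1 : ((N - q).descFactorial b : ℝ) / (N : ℝ) ^ b ≤ 1 := (div_le_one hP).2 hup
  have hx2 : 1 - (b * (q + b) : ℝ) / N ≤ ((N - q).descFactorial b : ℝ) / (N : ℝ) ^ b :=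
    (le_div_iff₀ hP).2 hlo
  rw [hdesc]
  have e : ((N - q).descFactorial b : ℝ) / b.factorial / (N : ℝ) ^ b - 1 / b.factorial
      = -((1 - ((N - q).descFactorial b : ℝ) / (N : ℝ) ^ b) / b.factorial) := by
    field_simp; ring
  rw [e, abs_neg, abs_of_nonneg (div_nonneg (by linarith) hb.le)]
  refine (div_le_self (by linarith) hb1).trans (by linarith)

lemma exists_polynomial_choose (q d : ℕ) :
    ∃ P : Polynomial ℝ, ∀ N : ℕ, q ≤ N → ((N - q).choose d : ℝ) = P.eval (N : ℝ) := by
  refine ⟨Polynomial.C ((d.factorial : ℝ)⁻¹) *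
    (descPochhammer ℝ d).comp (Polynomial.X - Polynomial.C (q : ℝ)), fun N hN => ?_⟩
  have h1 := descPochhammer_eval_eq_descFactorial ℝ (N - q) d
  rw [Nat.cast_sub hN, Nat.descFactorial_eq_factorial_mul_choose] at h1
  simp only [Polynomial.eval_mul, Polynomial.eval_C, Polynomial.eval_comp, Polynomial.eval_sub,
    Polynomial.eval_X]
  rw [h1]
  push_cast
  have : (d.factorial : ℝ) ≠ 0 := by positivity
  field_simp

lemma exists_tendsto_polynomial_div_pow (P : Polynomial ℝ) {m : ℕ} {C : ℝ}
    (hC : ∀ᶠ N : ℕ in Filter.atTop, |P.eval (N : ℝ)| ≤ C * (N : ℝ) ^ m) :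
    ∃ V : ℝ, Filter.Tendsto (fun N : ℕ => P.eval (N : ℝ) / (N : ℝ) ^ m) Filter.atTop (nhds V) := by
  rcases lt_or_ge (Polynomial.degree (Polynomial.X ^ m : Polynomial ℝ)) P.degree with h | h
  · exfalso
    have h1 := (Polynomial.abs_div_tendsto_atTop_atTop_of_degree_gt P (Polynomial.X ^ m) h
      (by simp)).comp (tendsto_natCast_atTop_atTop (R := ℝ))
    have h2 := h1.eventually (Filter.eventually_gt_atTop C)
    obtain ⟨N, ⟨hN1, hN2⟩, hN3⟩ := ((h2.and hC).and (Filter.eventually_gt_atTop 0)).exists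
    simp only [Function.comp, Polynomial.eval_pow, Polynomial.eval_X] at hN1
    have hp : (0 : ℝ) < (N : ℝ) ^ m := by positivity
    rw [abs_div, abs_of_pos hp, lt_div_iff₀ hp] at hN1
    linarith
  · rcases h.lt_or_eq with h | h
    · refine ⟨0, ?_⟩
      have h1 := (Polynomial.div_tendsto_atTop_zero_of_degree_lt P (Polynomial.X ^ m) h).comp
        (tendsto_natCast_atTop_atTop (R := ℝ))
      simpa [Function.comp_def] using h1
    · refine ⟨P.leadingCoeff / (Polynomial.X ^ m : Polynomial ℝ).leadingCoeff, ?_⟩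
      have h1 := (Polynomial.div_tendsto_atTop_leadingCoeff_div_of_degree_eq P (Polynomial.X ^ m) h).comp
        (tendsto_natCast_atTop_atTop (R := ℝ))
      simpa [Function.comp_def] using h1

end Counting

section Variance

open Equiv Equiv.Perm

/-- The adjacency constraints induced on `Fin k` by those of two tuples. -/
def mergedAdj {p k : ℕ} (Y : Finset ℕ) (a b : Fin p → Fin k) : Finset ℕ :=
  (univ.filter fun i : Fin p => (i : ℕ) ∈ Y).image (fun i => (a i : ℕ)) ∪
    (univ.filter fun i : Fin p => (i : ℕ) ∈ Y).image (fun i => (b i : ℕ))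

/-- Pairs of constrained tuples which jointly cover `Fin k`. -/
def coveringPairs (p k : ℕ) (Y : Finset ℕ) : Finset ((Fin p → Fin k) × (Fin p → Fin k)) :=
  (admissible p k Y ×ˢ admissible p k Y).filter fun ab =>
    Set.range ab.1 ∪ Set.range ab.2 = Set.univ

lemma mergedAdj_comm {p k : ℕ} (Y : Finset ℕ) (a b : Fin p → Fin k) :
    mergedAdj Y a b = mergedAdj Y b a := Finset.union_comm _ _

lemma mergedAdj_lt {p k : ℕ} {Y : Finset ℕ} (hY : ∀ y ∈ Y, y + 1 < p) {a b : Fin p → Fin k}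
    (ha : a ∈ admissible p k Y) (hb : b ∈ admissible p k Y) :
    ∀ y ∈ mergedAdj Y a b, y + 1 < k := by
  have key : ∀ c ∈ admissible p k Y, ∀ i : Fin p, (i : ℕ) ∈ Y → (c i : ℕ) + 1 < k :=
    fun c hc i hi => by
      have h := (Finset.mem_filter.1 hc).2.2 i (hY _ hi) hi
      have h2 := (c ⟨i + 1, hY _ hi⟩).isLt
      rwa [h] at h2
  intro y hy
  simp only [mergedAdj, Finset.mem_union, Finset.mem_image, Finset.mem_filter, Finset.mem_univ,
    true_and] at hy
  rcases hy with ⟨i, hi, rfl⟩ | ⟨i, hi, rfl⟩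
  · exact key a ha i hi
  · exact key b hb i hi

lemma comp_mem_admissible {p k N : ℕ} {Y : Finset ℕ} {a b : Fin p → Fin k}
    {γ : Fin k → Fin N} (ha : a ∈ admissible p k Y)
    (hγ : γ ∈ admissible k N (mergedAdj Y a b)) : γ ∘ a ∈ admissible p N Y := by
  simp only [admissible, Finset.mem_filter, Finset.mem_univ, true_and] at ha hγ ⊢
  refine ⟨hγ.1.comp ha.1, fun i h hi => ?_⟩
  have h1 := ha.2 i h hi
  have h2 : (a ⟨i, by omega⟩ : ℕ) + 1 < k := by rw [← h1]; exact Fin.isLt _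
  have h3 := hγ.2 (a ⟨i, by omega⟩) h2 (by
    refine Finset.mem_union_left _ (Finset.mem_image.2 ⟨⟨i, by omega⟩, by simpa using hi, rfl⟩))
  have h4 : a ⟨i + 1, h⟩ = ⟨(a ⟨i, by omega⟩ : ℕ) + 1, h2⟩ := Fin.ext h1
  simp only [Function.comp, h4, h3]

lemma mem_admissible_of_comp {p k N : ℕ} {Y : Finset ℕ} {a : Fin p → Fin k}
    {γ : Fin k → Fin N} (hγ : StrictMono γ) (h : γ ∘ a ∈ admissible p N Y) :
    a ∈ admissible p k Y := by
  simp only [admissible, Finset.mem_filter, Finset.mem_univ, true_and] at h ⊢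
  refine ⟨fun i j hij => hγ.lt_iff_lt.1 (h.1 hij), fun i hi hiY => ?_⟩
  have h1 := h.2 i hi hiY
  simp only [Function.comp] at h1
  have h2 : a ⟨i, by omega⟩ < a ⟨i + 1, hi⟩ := hγ.lt_iff_lt.1 (by
    rw [Fin.lt_def, h1]; omega)
  by_contra hne
  have hlt : (a ⟨i, by omega⟩ : ℕ) + 1 < a ⟨i + 1, hi⟩ := by
    have := Fin.lt_def.1 h2; omega
  have hk : (a ⟨i, by omega⟩ : ℕ) + 1 < k := hlt.trans (Fin.isLt _)
  have h3 : γ (a ⟨i, by omega⟩) < γ ⟨(a ⟨i, by omega⟩ : ℕ) + 1, hk⟩ := hγ (by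
    rw [Fin.lt_def]; simp)
  have h4 : γ ⟨(a ⟨i, by omega⟩ : ℕ) + 1, hk⟩ < γ (a ⟨i + 1, hi⟩) := hγ (by
    rw [Fin.lt_def]; exact hlt)
  rw [Fin.lt_def] at h3 h4
  omega

lemma mem_admissible_mergedAdj {p k N : ℕ} {Y : Finset ℕ} (hY : ∀ y ∈ Y, y + 1 < p)
    {a b : Fin p → Fin k} {γ : Fin k → Fin N} (hγ : StrictMono γ)
    (ha : γ ∘ a ∈ admissible p N Y) (hb : γ ∘ b ∈ admissible p N Y) :
    γ ∈ admissible k N (mergedAdj Y a b) := by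
  have key : ∀ c : Fin p → Fin k, γ ∘ c ∈ admissible p N Y → ∀ i : Fin p, (i : ℕ) ∈ Y →
      ∀ h : (c i : ℕ) + 1 < k, (γ ⟨(c i : ℕ) + 1, h⟩ : ℕ) = γ (c i) + 1 := fun c hc i hi h => by
    have h1 := (Finset.mem_filter.1 hc).2.2 i (hY _ hi) hi
    have h2 := (Finset.mem_filter.1 (mem_admissible_of_comp hγ hc)).2.2 i (hY _ hi) hi
    have h3 : c ⟨i + 1, hY _ hi⟩ = ⟨(c i : ℕ) + 1, h⟩ := Fin.ext h2
    simpa only [Function.comp, h3] using h1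
  refine Finset.mem_filter.2 ⟨Finset.mem_univ _, hγ, fun y h hy => ?_⟩
  simp only [mergedAdj, Finset.mem_union, Finset.mem_image, Finset.mem_filter, Finset.mem_univ,
    true_and] at hy
  rcases hy with ⟨i, hi, rfl⟩ | ⟨i, hi, rfl⟩
  · exact key a ha i hi h
  · exact key b hb i hi h

lemma sum_admissible_pairs {p : ℕ} (N : ℕ) {Y : Finset ℕ} (hY : ∀ y ∈ Y, y + 1 < p)
    (F : (Fin p → Fin N) → (Fin p → Fin N) → ℝ) :
    ∑ α ∈ admissible p N Y, ∑ β ∈ admissible p N Y, F α β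
      = ∑ k ∈ range (p + p + 1), ∑ ab ∈ coveringPairs p k Y,
          ∑ γ ∈ admissible k N (mergedAdj Y ab.1 ab.2), F (γ ∘ ab.1) (γ ∘ ab.2) := by
  have hrange : ∀ {k} {ab : (Fin p → Fin k) × (Fin p → Fin k)}, ab ∈ coveringPairs p k Y →
      ∀ γ : Fin k → Fin N, Set.range γ = Set.range (γ ∘ ab.1) ∪ Set.range (γ ∘ ab.2) :=
    fun {k ab} h γ => by
      rw [Set.range_comp, Set.range_comp, ← Set.image_union, (Finset.mem_filter.1 h).2,
        Set.image_univ]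
  rw [← Finset.sum_product']
  simp_rw [Finset.sum_sigma']
  symm
  refine Finset.sum_bij (fun x _ => (x.2.2 ∘ x.2.1.1, x.2.2 ∘ x.2.1.2)) ?_ ?_ ?_ ?_
  · rintro ⟨k, ab, γ⟩ h
    simp only [Finset.mem_sigma] at h
    have hab := Finset.mem_product.1 (Finset.mem_filter.1 h.2.1).1
    refine Finset.mem_product.2 ⟨comp_mem_admissible (γ := γ) hab.1 h.2.2,
      comp_mem_admissible (γ := γ) (b := ab.1) hab.2 ?_⟩
    rw [mergedAdj_comm]; exact h.2.2
  · rintro ⟨k, ⟨a, b⟩, γ⟩ h ⟨k', ⟨a', b'⟩, γ'⟩ h' heq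
    simp only [Finset.mem_sigma] at h h'
    simp only [Prod.mk.injEq] at heq
    have hr : Set.range γ = Set.range γ' := by
      rw [hrange h.2.1 γ, hrange h'.2.1 γ', heq.1, heq.2]
    have hγ : StrictMono γ := (Finset.mem_filter.1 h.2.2).2.1
    have hγ' : StrictMono γ' := (Finset.mem_filter.1 h'.2.2).2.1
    have hk : k = k' := by
      have h1 := Set.ncard_range_of_injective hγ.injective
      have h2 := Set.ncard_range_of_injective hγ'.injective
      rw [hr, h2] at h1
      simpa using h1.symm
    subst hk
    have hγe : γ = γ' := (hγ.range_inj hγ').1 hr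
    subst hγe
    have ha : a = a' := hγ.injective.comp_left heq.1
    have hb : b = b' := hγ.injective.comp_left heq.2
    rw [ha, hb]
  · rintro ⟨α, β⟩ h
    rw [Finset.mem_product] at h
    obtain ⟨γ, a, b, hα, hβ, hr⟩ := exists_common_embedding α β
    have ha : γ ∘ a ∈ admissible p N Y := by rw [← hα]; exact h.1
    have hb : γ ∘ b ∈ admissible p N Y := by rw [← hβ]; exact h.2
    have hr' : Set.range γ = Set.range (γ ∘ a) ∪ Set.range (γ ∘ b) := by rw [← hα, ← hβ]; exact hr
    refine ⟨⟨_, (a, b), γ⟩, ?_, by simp only [← hα, ← hβ]⟩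
    simp only [Finset.mem_sigma]
    refine ⟨?_, Finset.mem_filter.2 ⟨Finset.mem_product.2
      ⟨mem_admissible_of_comp γ.strictMono ha, mem_admissible_of_comp γ.strictMono hb⟩, ?_⟩,
      mem_admissible_mergedAdj hY γ.strictMono ha hb⟩
    · rw [Finset.mem_range]
      have h1 := Finset.card_union_le (univ.image α) (univ.image β)
      have h2 := Finset.card_image_le (s := univ) (f := α)
      have h3 := Finset.card_image_le (s := univ) (f := β)
      simp only [Finset.card_univ, Fintype.card_fin] at h2 h3
      omega
    · rw [Set.range_comp, Set.range_comp, ← Set.image_union, ← Set.image_univ] at hr'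
      exact (γ.injective.image_injective hr').symm
  · intros; rfl

lemma exists_polynomial_patVar {p : ℕ} (hp : 0 < p) (τ : Perm (Fin p)) {Y : Finset ℕ}
    (hY : ∀ y ∈ Y, y + 1 < p) :
    ∃ P : Polynomial ℝ, ∀ N : ℕ, 2 * p ≤ N →
      patVar τ (admissible p N Y) = P.eval (N : ℝ) := by
  choose P hP using exists_polynomial_choose
  refine ⟨∑ k ∈ range (p + p + 1), ∑ ab ∈ coveringPairs p k Y,
    Polynomial.C (∑ π, ewensW 1 π * (cPatInd τ ab.1 π * cPatInd τ ab.2 π)) *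
      P (mergedAdj Y ab.1 ab.2).card (k - (mergedAdj Y ab.1 ab.2).card), fun N hN => ?_⟩
  unfold patVar
  rw [sum_admissible_pairs N hY]
  simp only [Polynomial.eval_finsetSum, Polynomial.eval_mul, Polynomial.eval_C]
  refine Finset.sum_congr rfl fun k hk => Finset.sum_congr rfl fun ab hab => ?_
  have h1 := Finset.mem_product.1 (Finset.mem_filter.1 hab).1
  have hk0 : 0 < k := lt_of_le_of_lt (Nat.zero_le _) (ab.1 ⟨0, hp⟩).isLt
  have hlt := mergedAdj_lt hY h1.1 h1.2
  have hcard : (mergedAdj Y ab.1 ab.2).card ≤ k := by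
    have : mergedAdj Y ab.1 ab.2 ⊆ range k := fun y hy => by
      have := hlt y hy; rw [Finset.mem_range]; omega
    simpa using Finset.card_le_card this
  rw [← hP _ _ N (by rw [Finset.mem_range] at hk; omega), ← card_admissible N hk0 hlt]
  rw [Finset.sum_congr rfl (g := fun _ =>
    ∑ π, ewensW 1 π * (cPatInd τ ab.1 π * cPatInd τ ab.2 π))]
  · rw [Finset.sum_const, nsmul_eq_mul, mul_comm]
  · intro γ hγ
    exact sum_ewensW_cPatInd_comp τ ⟨γ, (Finset.mem_filter.1 hγ).2.1.injective⟩ ab.1 ab.2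

lemma exists_tendsto_patVar_div {p : ℕ} (hp : 0 < p) (τ : Perm (Fin p)) {Y : Finset ℕ}
    (hY : ∀ y ∈ Y, y + 1 < p) :
    ∃ V : NNReal, Filter.Tendsto (fun N : ℕ => patVar τ (admissible p N Y) /
      (N : ℝ) ^ ((p - Y.card) + (p - Y.card - 1))) Filter.atTop (nhds (V : ℝ)) := by
  obtain ⟨P, hP⟩ := exists_polynomial_patVar hp τ hY
  have hev : ∀ᶠ N : ℕ in Filter.atTop, patVar τ (admissible p N Y) = P.eval (N : ℝ) :=
    (Filter.eventually_ge_atTop (2 * p)).mono hP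
  obtain ⟨V, hV⟩ := exists_tendsto_polynomial_div_pow P
    (m := (p - Y.card) + (p - Y.card - 1)) (C := (p : ℝ) ^ 2) (by
      filter_upwards [hev] with N hN
      rw [← hN, abs_of_nonneg (patVar_nonneg _ _)]
      refine (patVar_le τ (D := ((p ^ 2 * N ^ (p - Y.card - 1) : ℕ) : ℝ))
        (fun α hα => (Finset.mem_filter.1 hα).2.1)
        fun α => by exact_mod_cast card_nbhd_admissible_le hY α).trans ?_
      have h1 : ((admissible p N Y).card : ℝ) ≤ (N : ℝ) ^ (p - Y.card) := by
        exact_mod_cast card_admissible_le hp hY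
      calc _ ≤ (N : ℝ) ^ (p - Y.card) * ((p ^ 2 * N ^ (p - Y.card - 1) : ℕ) : ℝ) := by gcongr
        _ = _ := by push_cast; ring)
  have hV' : Filter.Tendsto (fun N : ℕ => patVar τ (admissible p N Y) /
      (N : ℝ) ^ ((p - Y.card) + (p - Y.card - 1))) Filter.atTop (nhds V) :=
    hV.congr' (by filter_upwards [hev] with N hN; rw [hN])
  exact ⟨⟨V, ge_of_tendsto' hV' fun N => div_nonneg (patVar_nonneg _ _) (by positivity)⟩, hV'⟩

end Variance

section DiscreteLaw

open MeasureTheory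

variable {Ω : Type*} [Fintype Ω]

/-- The law of `Z` under the weights `w`. -/
def discreteLaw (w : Ω → ℝ) (Z : Ω → ℝ) : Measure ℝ :=
  ∑ ω, ENNReal.ofReal (w ω) • Measure.dirac (Z ω)

lemma isProbabilityMeasure_discreteLaw {w : Ω → ℝ} (hw : ∀ ω, 0 ≤ w ω) (hw1 : ∑ ω, w ω = 1)
    (Z : Ω → ℝ) : IsProbabilityMeasure (discreteLaw w Z) := by
  constructor
  simp only [discreteLaw, Measure.finsetSum_apply, Measure.smul_apply, measure_univ,
    smul_eq_mul, mul_one]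
  rw [← ENNReal.ofReal_sum_of_nonneg fun ω _ => hw ω, hw1, ENNReal.ofReal_one]

lemma integral_discreteLaw {E : Type*} [NormedAddCommGroup E] [NormedSpace ℝ E] [CompleteSpace E]
    {w : Ω → ℝ} (hw : ∀ ω, 0 ≤ w ω) (Z : Ω → ℝ) (f : ℝ → E) :
    ∫ x, f x ∂(discreteLaw w Z) = ∑ ω, w ω • f (Z ω) := by
  unfold discreteLaw
  rw [integral_finsetSum_measure]
  · refine Finset.sum_congr rfl fun ω _ => ?_
    rw [integral_smul_measure, integral_dirac, ENNReal.toReal_ofReal (hw ω)]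
  · intro ω _
    exact (integrable_dirac (by simp)).smul_measure ENNReal.ofReal_ne_top

lemma charFun_discreteLaw {w : Ω → ℝ} (hw : ∀ ω, 0 ≤ w ω) (Z : Ω → ℝ) (t : ℝ) :
    charFun (discreteLaw w Z) t = ∑ ω, w ω • Complex.exp (Complex.I * (t * Z ω : ℝ)) := by
  rw [charFun_apply_real, integral_discreteLaw hw]
  refine Finset.sum_congr rfl fun ω _ => ?_
  congr 2
  push_cast; ring

end DiscreteLaw

section Swap

open Equiv Equiv.Perm

lemma norm_exp_I_mul_sub_exp_I_mul_le (x y : ℝ) :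
    ‖Complex.exp (Complex.I * x) - Complex.exp (Complex.I * y)‖ ≤ |x - y| := by
  have h : Complex.exp (Complex.I * x) - Complex.exp (Complex.I * y)
      = Complex.exp (Complex.I * y) * (Complex.exp (Complex.I * (x - y : ℝ)) - 1) := by
    rw [mul_sub, ← Complex.exp_add, mul_one]; push_cast; ring_nf
  rw [h, norm_mul, mul_comm Complex.I (y : ℂ), Complex.norm_exp_ofReal_mul_I, one_mul]
  exact Real.norm_exp_I_mul_ofReal_sub_one_le

lemma abs_sum_cPatInd_swap_mul_sub_le {p N : ℕ} (τ : Perm (Fin p)) {Y : Finset ℕ}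
    (hY : ∀ y ∈ Y, y + 1 < p) (σ : Perm (Fin N)) (a b : Fin N) :
    |∑ α ∈ admissible p N Y, cPatInd τ α (swap a b * σ) - ∑ α ∈ admissible p N Y, cPatInd τ α σ|
      ≤ 2 * p * (N : ℝ) ^ (p - Y.card - 1) := by
  set T := admissible p N Y
  set H := (univ : Finset (Fin p)).biUnion fun i =>
    (T.filter fun α => α i = σ⁻¹ a) ∪ (T.filter fun α => α i = σ⁻¹ b) with hH
  have hHT : H ⊆ T := by
    intro α hα
    simp only [hH, Finset.mem_biUnion, Finset.mem_union, Finset.mem_filter] at hα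
    obtain ⟨i, -, h | h⟩ := hα <;> exact h.1
  have hcard : (H.card : ℝ) ≤ 2 * p * (N : ℝ) ^ (p - Y.card - 1) := by
    have : H.card ≤ (univ : Finset (Fin p)).card * (2 * N ^ (p - Y.card - 1)) := by
      refine Finset.card_biUnion_le_card_mul _ _ _ fun i _ => (Finset.card_union_le _ _).trans ?_
      rw [two_mul]
      exact add_le_add (card_admissible_filter_le hY i (σ⁻¹ a))
        (card_admissible_filter_le hY i (σ⁻¹ b))
    rw [Finset.card_univ, Fintype.card_fin] at this
    calc (H.card : ℝ) ≤ ((p * (2 * N ^ (p - Y.card - 1)) : ℕ) : ℝ) := by exact_mod_cast this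
      _ = _ := by push_cast; ring
  have hb : ∀ α, |cPatInd τ α (swap a b * σ) - cPatInd τ α σ| ≤ 1 := fun α => by
    rw [cPatInd, cPatInd, sub_sub_sub_cancel_right]
    unfold patInd
    split_ifs <;> norm_num
  rw [← Finset.sum_sub_distrib, ← Finset.sum_subset hHT]
  · refine (Finset.abs_sum_le_sum_abs _ _).trans ((Finset.sum_le_sum fun α _ => hb α).trans ?_)
    simpa using hcard
  · intro α hα hαH
    have hfix : ∀ i, (swap a b * σ) (α i) = σ (α i) := fun i => by
      have h : α i ≠ σ⁻¹ a ∧ α i ≠ σ⁻¹ b := by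
        constructor <;> intro h <;> apply hαH <;>
          simp only [hH, Finset.mem_biUnion, Finset.mem_union, Finset.mem_filter]
        · exact ⟨i, Finset.mem_univ _, Or.inl ⟨hα, h⟩⟩
        · exact ⟨i, Finset.mem_univ _, Or.inr ⟨hα, h⟩⟩
      refine swap_apply_of_ne_of_ne (fun h' => h.1 ?_) (fun h' => h.2 ?_) <;> simp [← h']
    simp only [cPatInd, patInd, hfix, sub_self]

lemma tendsto_harmonic_div_sqrt :
    Filter.Tendsto (fun N : ℕ => (∑ k ∈ range N, 1 / ((k : ℝ) + 1)) / Real.sqrt N)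
      Filter.atTop (nhds 0) := by
  have h1 : Filter.Tendsto (fun N : ℕ => 1 / Real.sqrt N + Real.log N / Real.sqrt N)
      Filter.atTop (nhds (0 + 0)) := by
    refine Filter.Tendsto.add ?_ ?_
    · simp only [one_div]
      exact (Real.tendsto_sqrt_atTop.comp tendsto_natCast_atTop_atTop).inv_tendsto_atTop
    · have := (isLittleO_log_rpow_atTop (r := 1 / 2) (by norm_num)).tendsto_div_nhds_zero.comp
        (tendsto_natCast_atTop_atTop (R := ℝ))
      simpa [Function.comp_def, Real.sqrt_eq_rpow] using this
  rw [add_zero] at h1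
  refine squeeze_zero (fun N => by positivity) (fun N => ?_) h1
  rw [← add_div]
  gcongr
  have := harmonic_le_one_add_log N
  simpa [harmonic] using this

end Swap

section Assembly

open Equiv Equiv.Perm

lemma occCount_eq_sum {N p : ℕ} (τ : Perm (Fin p)) (X : Finset (Fin (p - 1)))
    (σ : Perm (Fin N)) :
    (occCount τ X σ : ℝ) = ∑ α ∈ admissible p N (X.image Fin.val), patInd τ α σ := by
  unfold patInd
  rw [Finset.sum_boole, occCount, admissible, Finset.filter_filter]
  congr 2
  refine Finset.filter_congr fun f _ => ?_
  rw [and_assoc]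
  refine and_congr_right fun _ => and_congr_left fun _ => ⟨fun h i hi hiX => ?_, fun h x hx => ?_⟩
  · obtain ⟨x, hx, rfl⟩ := Finset.mem_image.1 hiX
    exact h x hx
  · exact h x (by omega) (Finset.mem_image_of_mem _ hx)

variable {p : ℕ} (τ : Perm (Fin p)) (X : Finset (Fin (p - 1)))

lemma add_one_lt_of_mem_image_val : ∀ y ∈ X.image Fin.val, y + 1 < p := by
  intro y hy
  obtain ⟨x, -, rfl⟩ := Finset.mem_image.1 hy
  omega

lemma card_image_val : (X.image Fin.val).card = X.card :=
  Finset.card_image_of_injective _ Fin.val_injective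

/-- The centered and rescaled number of occurrences of a dashed pattern. -/
def normalizedOcc {N : ℕ} (σ : Perm (Fin N)) : ℝ :=
  Real.sqrt N * ((occCount τ X σ : ℝ) / (N : ℝ) ^ (p - X.card)
    - 1 / ((Nat.factorial p : ℝ) * (Nat.factorial (p - X.card) : ℝ)))

/-- The error made when centering by the leading term of the mean. -/
def meanError (N : ℕ) : ℝ :=
  Real.sqrt N * (((N - X.card).choose (p - X.card) : ℝ) / (N : ℝ) ^ (p - X.card)
    - 1 / ((p - X.card).factorial : ℝ)) / p.factorial

lemma normalizedOcc_eq (hp : 0 < p) {N : ℕ} (σ : Perm (Fin N)) :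
    normalizedOcc τ X σ = Real.sqrt N / (N : ℝ) ^ (p - X.card) *
      ∑ α ∈ admissible p N (X.image Fin.val), cPatInd τ α σ + meanError X N := by
  have hcard := card_admissible N hp (add_one_lt_of_mem_image_val X)
  rw [card_image_val] at hcard
  unfold normalizedOcc meanError cPatInd
  rw [Finset.sum_sub_distrib, ← occCount_eq_sum, Finset.sum_const, hcard, nsmul_eq_mul]
  ring

lemma tendsto_meanError : Filter.Tendsto (meanError X) Filter.atTop (nhds 0) := by
  set C : ℝ := ((p - X.card : ℕ) : ℝ) * (X.card + (p - X.card : ℕ))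
  have h0 : Filter.Tendsto (fun N : ℕ => C * (Real.sqrt N)⁻¹) Filter.atTop (nhds (C * 0)) :=
    ((Real.tendsto_sqrt_atTop.comp tendsto_natCast_atTop_atTop).inv_tendsto_atTop).const_mul C
  rw [mul_zero] at h0
  refine squeeze_zero_norm' ?_ h0
  filter_upwards [Filter.eventually_ge_atTop (X.card + (p - X.card)),
    Filter.eventually_gt_atTop 0] with N hN hN0
  have h1 := choose_div_pow_bounds hN hN0
  have hs : (0 : ℝ) < Real.sqrt N := Real.sqrt_pos.2 (by exact_mod_cast hN0)
  have hf : (1 : ℝ) ≤ p.factorial := by exact_mod_cast p.factorial_pos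
  have hss : Real.sqrt N * Real.sqrt N = N := Real.mul_self_sqrt (Nat.cast_nonneg N)
  rw [meanError, norm_div, norm_mul, Real.norm_eq_abs, Real.norm_eq_abs, Real.norm_eq_abs,
    abs_of_pos hs, abs_of_pos (zero_lt_one.trans_le hf)]
  refine (div_le_self (by positivity) hf).trans ?_
  calc _ ≤ Real.sqrt N * (C / N) := by gcongr
    _ = C * (Real.sqrt N)⁻¹ := by
        nth_rewrite 2 [← hss]
        field_simp

lemma sqrt_div_pow_mul_pow {b N : ℕ} (hb : 0 < b) (hN : 0 < N) :
    Real.sqrt N / (N : ℝ) ^ b * (N : ℝ) ^ (b - 1) = (Real.sqrt N)⁻¹ := by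
  have hN' : (0 : ℝ) < N := by exact_mod_cast hN
  have hs : (0 : ℝ) < Real.sqrt N := Real.sqrt_pos.2 hN'
  have hss : Real.sqrt N * Real.sqrt N = N := Real.mul_self_sqrt hN'.le
  obtain ⟨c, rfl⟩ : ∃ c, b = c + 1 := ⟨b - 1, by omega⟩
  rw [Nat.add_sub_cancel, pow_succ]
  field_simp
  rw [sq, hss]

lemma card_lt (hp : 0 < p) : 0 < p - X.card := by
  have := X.card_le_univ
  rw [Fintype.card_fin] at this
  omega

lemma tendsto_charFun_uniform (hp : 0 < p) {V : ℝ}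
    (hV : Filter.Tendsto (fun N : ℕ => patVar τ (admissible p N (X.image Fin.val)) /
      (N : ℝ) ^ ((p - X.card) + (p - X.card - 1))) Filter.atTop (nhds V)) (t : ℝ) :
    Filter.Tendsto (fun N : ℕ => ∑ σ : Perm (Fin N),
        ewensW 1 σ • Complex.exp (Complex.I * (t * normalizedOcc τ X σ : ℝ)))
      Filter.atTop (nhds (Complex.exp (-(V * t ^ 2 / 2 : ℝ)))) := by
  have hb := card_lt X hp
  set b := p - X.card with hbdef
  set Y := X.image Fin.val with hYdef
  have hY : ∀ y ∈ Y, y + 1 < p := add_one_lt_of_mem_image_val X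
  have hYc : Y.card = X.card := card_image_val X
  set s : ℕ → ℝ := fun N => t * (Real.sqrt N / (N : ℝ) ^ b) with hs
  have hfac : ∀ N : ℕ, ∑ σ : Perm (Fin N),
      ewensW 1 σ • Complex.exp (Complex.I * (t * normalizedOcc τ X σ : ℝ))
      = Complex.exp (Complex.I * (t * meanError X N : ℝ)) * wexp (ewensW 1) (fun σ =>
        Complex.exp (Complex.I * (s N * ∑ α ∈ admissible p N Y, cPatInd τ α σ : ℝ))) := by
    intro N
    rw [← wexp_const_mul]
    refine Finset.sum_congr rfl fun σ _ => ?_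
    dsimp only
    rw [Complex.real_smul, ← Complex.exp_add, normalizedOcc_eq τ X hp]
    congr 2
    simp only [hs]
    push_cast; ring
  simp_rw [hfac]
  have h1 : Filter.Tendsto (fun N : ℕ => Complex.exp (Complex.I * (t * meanError X N : ℝ)))
      Filter.atTop (nhds 1) := by
    have hc : Continuous fun x : ℝ => Complex.exp (Complex.I * (t * x : ℝ)) := by fun_prop
    have h := (hc.tendsto 0).comp (tendsto_meanError X)
    simpa [Function.comp_def] using h
  have h2 : Filter.Tendsto (fun N : ℕ => Complex.exp
      (-(patVar τ (admissible p N Y) * s N ^ 2 / 2 : ℝ)))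
      Filter.atTop (nhds (Complex.exp (-(V * t ^ 2 / 2 : ℝ)))) := by
    have h : Filter.Tendsto (fun N : ℕ => patVar τ (admissible p N Y) * s N ^ 2 / 2)
        Filter.atTop (nhds (V * t ^ 2 / 2)) := by
      refine ((hV.mul_const (t ^ 2)).div_const 2).congr' ?_
      filter_upwards [Filter.eventually_gt_atTop 0] with N hN
      have hN' : (0 : ℝ) < N := by exact_mod_cast hN
      simp only [hs]
      rw [mul_pow, div_pow, Real.sq_sqrt hN'.le]
      obtain ⟨c, hc⟩ : ∃ c, b = c + 1 := ⟨b - 1, by omega⟩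
      rw [hc, Nat.add_sub_cancel]
      field_simp
      ring
    exact (Complex.continuous_exp.tendsto _).comp
      ((Complex.continuous_ofReal.tendsto _).comp h).neg
  have h3 : Filter.Tendsto (fun N : ℕ => wexp (ewensW 1) (fun σ =>
        Complex.exp (Complex.I * (s N * ∑ α ∈ admissible p N Y, cPatInd τ α σ : ℝ)))
      - Complex.exp (-(patVar τ (admissible p N Y) * s N ^ 2 / 2 : ℝ)))
      Filter.atTop (nhds 0) := by
    have h0 : Filter.Tendsto (fun N : ℕ => 7 * |t| ^ 3 * (p : ℝ) ^ 4 * (Real.sqrt N)⁻¹)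
        Filter.atTop (nhds (7 * |t| ^ 3 * (p : ℝ) ^ 4 * 0)) :=
      ((Real.tendsto_sqrt_atTop.comp tendsto_natCast_atTop_atTop).inv_tendsto_atTop).const_mul _
    rw [mul_zero] at h0
    refine squeeze_zero_norm' ?_ h0
    filter_upwards [Filter.eventually_gt_atTop 0] with N hN
    refine (norm_wexp_uniform_sub_gaussian_le τ (D := ((p ^ 2 * N ^ (b - 1) : ℕ) : ℝ))
      (fun α hα => (Finset.mem_filter.1 hα).2.1) (fun α => ?_) _).trans ?_
    · have := card_nbhd_admissible_le hY α
      rw [hYc] at this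
      exact_mod_cast this
    · have hc : ((admissible p N Y).card : ℝ) ≤ (N : ℝ) ^ b := by
        have := card_admissible_le (N := N) hp hY
        rw [hYc] at this
        exact_mod_cast this
      have hN' : (0 : ℝ) < N := by exact_mod_cast hN
      have hsq : (0 : ℝ) < Real.sqrt N := Real.sqrt_pos.2 hN'
      have hss := sqrt_div_pow_mul_pow hb hN
      have hs1 : |s N| = |t| * (Real.sqrt N / (N : ℝ) ^ b) := by
        rw [hs, abs_mul, abs_of_nonneg (a := Real.sqrt N / (N : ℝ) ^ b) (by positivity)]
      calc _ ≤ 7 * |s N| ^ 3 * ((p ^ 2 * N ^ (b - 1) : ℕ) : ℝ) ^ 2 * (N : ℝ) ^ b := by gcongr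
        _ = 7 * |t| ^ 3 * (p : ℝ) ^ 4 *
            ((Real.sqrt N / (N : ℝ) ^ b * (N : ℝ) ^ (b - 1)) ^ 2 *
              (Real.sqrt N / (N : ℝ) ^ b * (N : ℝ) ^ b)) := by
            rw [hs1]; push_cast; ring
        _ = _ := by
            rw [hss, div_mul_cancel₀ _ (by positivity)]
            field_simp
  have h4 := h1.mul (h3.add h2)
  simpa using h4

lemma tendsto_charFun_sub_uniform (hp : 0 < p) {θ : ℝ} (hθ : 0 < θ) (t : ℝ) :
    Filter.Tendsto (fun N : ℕ => ∑ σ : Perm (Fin N),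
        ewensW θ σ • Complex.exp (Complex.I * (t * normalizedOcc τ X σ : ℝ))
      - ∑ σ : Perm (Fin N),
        ewensW 1 σ • Complex.exp (Complex.I * (t * normalizedOcc τ X σ : ℝ)))
      Filter.atTop (nhds 0) := by
  have h0 := tendsto_harmonic_div_sqrt.const_mul (|t| * (2 * p) * (2 * |θ - 1|))
  rw [mul_zero] at h0
  refine squeeze_zero_norm' ?_ h0
  filter_upwards [Filter.eventually_gt_atTop 0] with N hN
  refine (norm_sum_ewensW_sub_le hθ (L := |t| * (2 * p) * (Real.sqrt N)⁻¹) N _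
    fun σ a b => ?_).trans (le_of_eq (by ring))
  refine (norm_exp_I_mul_sub_exp_I_mul_le _ _).trans ?_
  rw [← mul_sub, abs_mul, normalizedOcc_eq τ X hp, normalizedOcc_eq τ X hp, add_sub_add_right_eq_sub,
    ← mul_sub, abs_mul, abs_of_nonneg (a := Real.sqrt N / (N : ℝ) ^ (p - X.card)) (by positivity),
    ← sqrt_div_pow_mul_pow (card_lt X hp) hN]
  have h := abs_sum_cPatInd_swap_mul_sub_le τ (add_one_lt_of_mem_image_val X) σ a b
  rw [card_image_val] at h
  calc _ ≤ |t| * (Real.sqrt N / (N : ℝ) ^ (p - X.card) *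
        (2 * p * (N : ℝ) ^ (p - X.card - 1))) := by gcongr
    _ = _ := by ring

end Assembly

/-- Theorem 1.7, second part: central limit theorem for the number of occurrences of a
dashed pattern `(τ,X)` of size `p` with `q = |X|` in an Ewens(θ) random permutation:
`Z^{(N)} = √N (O^{(N)}_{τ,X}/N^{p−q} − 1/(p!(p−q)!))` converges in distribution to a
centered Gaussian with some variance `V_{τ,X} ≥ 0`. -/
theorem dashed_pattern_clt (θ : ℝ) (hθ : 0 < θ) (p : ℕ) (hp : 0 < p)
    (τ : Equiv.Perm (Fin p)) (X : Finset (Fin (p - 1))) :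
    ∃ V : NNReal, ∀ f : BoundedContinuousFunction ℝ ℝ,
      Filter.Tendsto
        (fun N => ewensE θ N (fun σ =>
          f (Real.sqrt N * ((occCount τ X σ : ℝ) / (N : ℝ) ^ (p - X.card)
            - 1 / ((Nat.factorial p : ℝ) * (Nat.factorial (p - X.card) : ℝ))))))
        Filter.atTop
        (nhds (∫ y, f y ∂(ProbabilityTheory.gaussianReal 0 V))) := by
  obtain ⟨V, hV⟩ := exists_tendsto_patVar_div hp τ (add_one_lt_of_mem_image_val X)
  rw [card_image_val] at hV
  refine ⟨V, ?_⟩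
  let μ : ℕ → MeasureTheory.ProbabilityMeasure ℝ := fun N =>
    ⟨discreteLaw (ewensW θ) (normalizedOcc (N := N) τ X),
      isProbabilityMeasure_discreteLaw (ewensW_nonneg hθ) (sum_ewensW hθ N) _⟩
  let μ₀ : MeasureTheory.ProbabilityMeasure ℝ :=
    ⟨ProbabilityTheory.gaussianReal 0 V, inferInstance⟩
  have hμ : Filter.Tendsto μ Filter.atTop (nhds μ₀) := by
    refine MeasureTheory.ProbabilityMeasure.tendsto_iff_tendsto_charFun.2 fun t => ?_
    have h := (tendsto_charFun_sub_uniform τ X hp hθ t).add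
      (tendsto_charFun_uniform τ X hp hV t)
    simp only [sub_add_cancel, zero_add] at h
    have e : MeasureTheory.charFun (μ₀ : MeasureTheory.Measure ℝ) t
        = Complex.exp (-(V * t ^ 2 / 2 : ℝ)) := by
      change MeasureTheory.charFun (ProbabilityTheory.gaussianReal 0 V) t = _
      rw [ProbabilityTheory.charFun_gaussianReal]
      congr 1
      push_cast; ring
    rw [e]
    refine h.congr fun N => (charFun_discreteLaw (ewensW_nonneg hθ) _ t).symm
  intro f
  refine (MeasureTheory.ProbabilityMeasure.tendsto_iff_forall_integral_tendsto.1 hμ f).congr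
    fun N => ?_
  rw [ewensE_eq_sum]
  exact integral_discreteLaw (ewensW_nonneg hθ) _ f

end
end

section
/- Fix θ > 0, an integer N ≥ 1, and an integer r ≤ N. Let i_1, …, i_r be distinct elements of [N] and s_1, …, s_r be distinct elements of [N] (an entry of the list i may equal an entry of the list s). If σ is an Ewens(θ)-distributed random permutation of S_N, then E[ B^{(N)}_{i_1,s_1} ⋯ B^{(N)}_{i_r,s_r} ] = θ^{c} / ( (N+θ−1)(N+θ−2)⋯(N+θ−r) ), where c is the number of cycles of the partial permutation sending i_j to s_j for each j, i.e. the number of cyclic sequences of distinct indices (j_1, …, j_γ) with s_{j_1} = i_{j_2}, s_{j_2} = i_{j_3}, …, s_{j_{γ−1}} = i_{j_γ}, and s_{j_γ} = i_{j_1}. -/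
open scoped BigOperators Classical
open Finset

noncomputable section

/-- Number of cycles of the partial permutation sending `i j` to `s j` (for `i`, `s`
injective).  A cycle corresponds exactly to a minimal nonempty set of indices `C` whose
`i`-values coincide with its `s`-values, so `c` is the number of such minimal sets. -/
def partialCycles {N r : ℕ} (i s : Fin r → Fin N) : ℕ :=
  ((Finset.univ : Finset (Finset (Fin r))).filter (fun C => C.Nonempty ∧
    C.image i = C.image s ∧
    ∀ D ⊆ C, D.Nonempty → D.image i = D.image s → D = C)).card

/-- `A` is the underlying set of a cycle of `σ` (fixed points included). -/
def IsCycleSet {N : ℕ} (σ : Equiv.Perm (Fin N)) (A : Finset (Fin N)) : Prop :=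
  A.Nonempty ∧ A.image σ = A ∧ ∀ D ⊆ A, D.Nonempty → D.image σ = D → D = A

/-- The underlying set of the cycle of `σ` through `x`. -/
def cycleThrough {N : ℕ} (σ : Equiv.Perm (Fin N)) (x : Fin N) : Finset (Fin N) :=
  Finset.univ.filter (fun y => σ.SameCycle x y)

/-- The number of cycles of `σ` (fixed points included) lying inside `R`. -/
def cyclesInside {N : ℕ} (σ : Equiv.Perm (Fin N)) (R : Finset (Fin N)) : ℕ :=
  ((Finset.univ : Finset (Finset (Fin N))).filter (fun A => A ⊆ R ∧ IsCycleSet σ A)).card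

theorem mem_cycleThrough {N : ℕ} {σ : Equiv.Perm (Fin N)} {x y : Fin N} :
    y ∈ cycleThrough σ x ↔ σ.SameCycle x y := by
  simp [cycleThrough]

theorem self_mem_cycleThrough {N : ℕ} (σ : Equiv.Perm (Fin N)) (x : Fin N) :
    x ∈ cycleThrough σ x :=
  mem_cycleThrough.2 (Equiv.Perm.SameCycle.refl σ x)

theorem cycleThrough_eq {N : ℕ} {σ : Equiv.Perm (Fin N)} {x y : Fin N}
    (h : y ∈ cycleThrough σ x) : cycleThrough σ y = cycleThrough σ x := by
  ext z
  have hxy := mem_cycleThrough.1 h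
  simp only [mem_cycleThrough]
  exact ⟨hxy.trans, hxy.symm.trans⟩

/-- A set mapped into itself by `σ` contains the cycle through each of its elements. -/
theorem cycleThrough_subset {N : ℕ} {σ : Equiv.Perm (Fin N)} {D : Finset (Fin N)} {x : Fin N}
    (hD : ∀ y ∈ D, σ y ∈ D) (hx : x ∈ D) : cycleThrough σ x ⊆ D := by
  intro y hy
  obtain ⟨n, rfl⟩ := (mem_cycleThrough.1 hy).exists_nat_pow_eq
  induction n with
  | zero => simpa using hx
  | succ n ih =>
    rw [pow_succ', Equiv.Perm.mul_apply]
    exact hD _ (ih (mem_cycleThrough.2 ⟨n, by simp⟩))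

theorem apply_mem_of_image_eq {N : ℕ} {σ : Equiv.Perm (Fin N)} {D : Finset (Fin N)}
    (hD : D.image σ = D) : ∀ y ∈ D, σ y ∈ D := fun y hy => by
  have := Finset.mem_image_of_mem σ hy
  rwa [hD] at this

theorem isCycleSet_cycleThrough {N : ℕ} (σ : Equiv.Perm (Fin N)) (x : Fin N) :
    IsCycleSet σ (cycleThrough σ x) := by
  refine ⟨⟨x, self_mem_cycleThrough σ x⟩, ?_, ?_⟩
  · apply Finset.eq_of_subset_of_card_le
    · intro y hy
      obtain ⟨z, hz, rfl⟩ := Finset.mem_image.1 hy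
      exact mem_cycleThrough.2 (Equiv.Perm.sameCycle_apply_right.2 (mem_cycleThrough.1 hz))
    · rw [Finset.card_image_of_injective _ σ.injective]
  · rintro D hDA ⟨y, hy⟩ hD
    apply Finset.Subset.antisymm hDA
    rw [← cycleThrough_eq (hDA hy)]
    exact cycleThrough_subset (apply_mem_of_image_eq hD) hy

theorem IsCycleSet.eq_cycleThrough {N : ℕ} {σ : Equiv.Perm (Fin N)} {A : Finset (Fin N)}
    (hA : IsCycleSet σ A) {x : Fin N} (hx : x ∈ A) : A = cycleThrough σ x :=
  (hA.2.2 _ (cycleThrough_subset (apply_mem_of_image_eq hA.2.1) hx)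
    ⟨x, self_mem_cycleThrough σ x⟩ (isCycleSet_cycleThrough σ x).2.1).symm

theorem cyclesInside_congr {N : ℕ} {σ τ : Equiv.Perm (Fin N)} {R : Finset (Fin N)}
    (h : ∀ x ∈ R, σ x = τ x) : cyclesInside σ R = cyclesInside τ R := by
  have him : ∀ D ⊆ R, D.image σ = D.image τ := fun D hD =>
    Finset.image_congr fun x hx => h x (hD hx)
  unfold cyclesInside
  congr 1
  ext A
  simp only [Finset.mem_filter, Finset.mem_univ, true_and]
  refine and_congr_right fun hA => ?_
  unfold IsCycleSet
  rw [him A hA]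
  refine and_congr_right fun _ => and_congr_right fun _ => forall_congr' fun D =>
    forall_congr' fun hD => ?_
  rw [him D (hD.trans hA)]

theorem cyclesInside_insert {N : ℕ} (σ : Equiv.Perm (Fin N)) {R : Finset (Fin N)} {a : Fin N}
    (ha : a ∉ R) :
    cyclesInside σ (insert a R) =
      cyclesInside σ R + if cycleThrough σ a ⊆ insert a R then 1 else 0 := by
  unfold cyclesInside
  have key : ∀ A, (A ⊆ insert a R ∧ IsCycleSet σ A) ↔
      ((A ⊆ R ∧ IsCycleSet σ A) ∨ (A = cycleThrough σ a ∧ cycleThrough σ a ⊆ insert a R)) := by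
    intro A
    constructor
    · rintro ⟨h1, h2⟩
      by_cases haA : a ∈ A
      · have := h2.eq_cycleThrough haA
        exact Or.inr ⟨this, this ▸ h1⟩
      · exact Or.inl ⟨(Finset.subset_insert_iff_of_notMem haA).1 h1, h2⟩
    · rintro (⟨h1, h2⟩ | ⟨rfl, h⟩)
      · exact ⟨h1.trans (Finset.subset_insert a R), h2⟩
      · exact ⟨h, isCycleSet_cycleThrough σ a⟩
  simp only [key]
  split_ifs with h
  · rw [Finset.filter_or, Finset.card_union_of_disjoint]
    · simp only [h, and_true]
      congr 1
      exact Finset.card_eq_one.2 ⟨cycleThrough σ a, by ext; simp⟩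
    · rw [Finset.disjoint_filter]
      rintro A - ⟨h1, -⟩ ⟨rfl, -⟩
      exact ha (h1 (self_mem_cycleThrough σ a))
  · simp [h]

theorem cyclesInside_univ {N : ℕ} (σ : Equiv.Perm (Fin N)) :
    cyclesInside σ Finset.univ = cycleCount σ := by
  have hsupp : ∀ c ∈ σ.cycleFactorsFinset, ∀ x ∈ c.support, c.support = cycleThrough σ x := by
    intro c hc x hx
    have hσx : σ x ≠ x :=
      Equiv.Perm.mem_support.1 (Equiv.Perm.mem_cycleFactorsFinset_support_le hc hx)
    rw [Equiv.Perm.cycle_is_cycleOf hx hc]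
    ext y
    rw [Equiv.Perm.mem_support_cycleOf_iff' hσx, mem_cycleThrough]
  have hne : ∀ c ∈ σ.cycleFactorsFinset, c.support.Nonempty := fun c hc =>
    (Equiv.Perm.mem_cycleFactorsFinset_iff.1 hc).1.nonempty_support
  have hset : (Finset.univ : Finset (Finset (Fin N))).filter
        (fun A => A ⊆ Finset.univ ∧ IsCycleSet σ A) =
      σ.cycleFactorsFinset.image (fun c => c.support) ∪
        (σ.supportᶜ).image (fun x => ({x} : Finset (Fin N))) := by
    ext A
    simp only [Finset.mem_filter, Finset.mem_univ, Finset.subset_univ, true_and,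
      Finset.mem_union, Finset.mem_image, Finset.mem_compl]
    constructor
    · intro hA
      obtain ⟨x, hx⟩ := hA.1
      have hAx := hA.eq_cycleThrough hx
      by_cases hσx : x ∈ σ.support
      · refine Or.inl ⟨σ.cycleOf x, Equiv.Perm.cycleOf_mem_cycleFactorsFinset_iff.2 hσx, ?_⟩
        ext y
        rw [Equiv.Perm.mem_support_cycleOf_iff' (Equiv.Perm.mem_support.1 hσx), hAx,
          mem_cycleThrough]
      · refine Or.inr ⟨x, hσx, hA.2.2 _ (by simpa using hx) (by simp) ?_⟩
        rw [Finset.image_singleton, Equiv.Perm.notMem_support.1 hσx]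
    · rintro (⟨c, hc, rfl⟩ | ⟨x, hx, rfl⟩)
      · obtain ⟨x, hx⟩ := hne c hc
        rw [hsupp c hc x hx]
        exact isCycleSet_cycleThrough σ x
      · refine ⟨by simp, by simpa using hx, fun D hD hDne _ => ?_⟩
        exact (Finset.subset_singleton_iff.1 hD).resolve_left hDne.ne_empty
  unfold cyclesInside cycleCount
  rw [hset, Finset.card_union_of_disjoint, Finset.card_image_of_injOn,
    Finset.card_image_of_injective _ Finset.singleton_injective, Finset.card_compl,
    Equiv.Perm.sum_cycleType, Equiv.Perm.cycleType_def, Multiset.card_map, Fintype.card_fin]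
  · rfl
  · intro c hc d hd hcd
    obtain ⟨x, hx⟩ := hne c hc
    have hx' : x ∈ d.support := by
      have hcd' : c.support = d.support := hcd
      rwa [← hcd']
    rw [Equiv.Perm.cycle_is_cycleOf hx hc, Equiv.Perm.cycle_is_cycleOf hx' hd]
  · rw [Finset.disjoint_left]
    intro A hA hA'
    obtain ⟨c, hc, rfl⟩ := Finset.mem_image.1 hA
    obtain ⟨x, hx, hxc⟩ := Finset.mem_image.1 hA'
    have hxc' : x ∈ c.support := by simp [← hxc]
    exact Finset.mem_compl.1 hx (Equiv.Perm.mem_cycleFactorsFinset_support_le hc hxc')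

theorem partialCycles_eq_cyclesInside {N r : ℕ} {i s : Fin r → Fin N}
    (hi : Function.Injective i) (σ : Equiv.Perm (Fin N)) (hσ : ∀ j, σ (i j) = s j) :
    partialCycles i s = cyclesInside σ (Finset.univ.image i) := by
  have him : ∀ C : Finset (Fin r), (C.image i).image σ = C.image s := by
    intro C
    rw [Finset.image_image]
    exact Finset.image_congr fun j _ => hσ j
  have hinj : Function.Injective (fun C : Finset (Fin r) => C.image i) :=
    Finset.image_injective hi
  have hcyc : ∀ C : Finset (Fin r), IsCycleSet σ (C.image i) ↔ (C.Nonempty ∧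
      C.image i = C.image s ∧ ∀ D ⊆ C, D.Nonempty → D.image i = D.image s → D = C) := by
    intro C
    unfold IsCycleSet
    rw [Finset.image_nonempty, him, eq_comm (a := C.image s)]
    refine and_congr_right fun _ => and_congr_right fun _ => ⟨fun h D hD hne hDs => ?_, ?_⟩
    · exact hinj (h _ (Finset.image_subset_image hD) (hne.image i) ((him D).trans hDs.symm))
    · intro h D hD hne hDσ
      obtain ⟨D, hD', rfl⟩ := Finset.subset_image_iff.1 hD
      rw [him] at hDσ
      rw [h D hD' (Finset.image_nonempty.1 hne) hDσ.symm]
  unfold partialCycles cyclesInside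
  rw [← Finset.card_image_of_injective _ hinj]
  congr 1
  ext A
  simp only [Finset.mem_filter, Finset.mem_univ, true_and, Finset.mem_image]
  constructor
  · rintro ⟨C, hC, rfl⟩
    exact ⟨Finset.image_subset_image (Finset.subset_univ C), (hcyc C).2 hC⟩
  · rintro ⟨hA, hA'⟩
    obtain ⟨C, -, rfl⟩ := Finset.subset_image_iff.1 hA
    exact ⟨C, (hcyc C).1 hA', rfl⟩

/-- Extending a partial permutation with domain `R` by a value `b` at a new point `a` closes a
cycle for exactly one choice of `b`. -/
theorem exists_closing_value {N : ℕ} (σ₀ : Equiv.Perm (Fin N)) {R : Finset (Fin N)} {a : Fin N}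
    (ha : a ∉ R) :
    ∃ β, β ∉ R.image σ₀ ∧ ∀ σ : Equiv.Perm (Fin N), (∀ x ∈ R, σ x = σ₀ x) →
      (cycleThrough σ a ⊆ insert a R ↔ σ a = β) := by
  have hex : ∃ k : ℕ, (σ₀⁻¹ ^ (k + 1)) a ∉ R := by
    refine ⟨orderOf σ₀⁻¹ - 1, ?_⟩
    rw [Nat.sub_add_cancel (orderOf_pos _), pow_orderOf_eq_one]
    simpa using ha
  set k := Nat.find hex with hk
  have hkR : (σ₀⁻¹ ^ (k + 1)) a ∉ R := Nat.find_spec hex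
  have hlt : ∀ j < k, (σ₀⁻¹ ^ (j + 1)) a ∈ R := fun j hj => by
    simpa using Nat.find_min hex hj
  have hstep : ∀ j, σ₀ ((σ₀⁻¹ ^ (j + 1)) a) = (σ₀⁻¹ ^ j) a := fun j => by
    rw [pow_succ', Equiv.Perm.mul_apply]
    exact σ₀.apply_symm_apply _
  refine ⟨(σ₀⁻¹ ^ k) a, ?_, fun σ hσ => ?_⟩
  · rw [Finset.mem_image]
    rintro ⟨x, hx, hxk⟩
    rw [← hstep k] at hxk
    exact hkR (σ₀.injective hxk ▸ hx)
  have hσstep : ∀ j < k, σ ((σ₀⁻¹ ^ (j + 1)) a) = (σ₀⁻¹ ^ j) a := fun j hj => by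
    rw [hσ _ (hlt j hj), hstep]
  constructor
  · intro hsub
    have hmem : ∀ j ≤ k, σ.SameCycle a ((σ₀⁻¹ ^ j) a) := by
      intro j
      induction j with
      | zero => intro _; simpa using Equiv.Perm.SameCycle.refl σ a
      | succ j ih =>
        intro hj
        rw [← Equiv.Perm.sameCycle_apply_right, hσstep j hj]
        exact ih (by omega)
    have hpre : σ.symm ((σ₀⁻¹ ^ k) a) ∈ insert a R :=
      hsub (mem_cycleThrough.2 (Equiv.Perm.sameCycle_symm_apply_right.2 (hmem k le_rfl)))
    rcases Finset.mem_insert.1 hpre with h | h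
    · exact ((Equiv.symm_apply_eq σ).1 h).symm
    · have h2 := hσ _ h
      rw [Equiv.apply_symm_apply] at h2
      have h3 := σ₀.injective ((hstep k).trans h2)
      exact absurd (h3 ▸ h) hkR
  · intro hσa
    have hclosed : cycleThrough σ a ⊆ (Finset.range (k + 1)).image (fun j => (σ₀⁻¹ ^ j) a) := by
      apply cycleThrough_subset
      · intro y hy
        obtain ⟨j, hj, rfl⟩ := Finset.mem_image.1 hy
        rw [Finset.mem_range] at hj
        rw [Finset.mem_image]
        cases j with
        | zero => exact ⟨k, by simp, by simpa using hσa.symm⟩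
        | succ j => exact ⟨j, Finset.mem_range.2 (by omega), (hσstep j (by omega)).symm⟩
      · exact Finset.mem_image.2 ⟨0, by simp, by simp⟩
    refine hclosed.trans fun y hy => ?_
    obtain ⟨j, hj, rfl⟩ := Finset.mem_image.1 hy
    rw [Finset.mem_range] at hj
    cases j with
    | zero => simp
    | succ j => exact Finset.mem_insert_of_mem (hlt j (by omega))

/-- The total Ewens weight of the permutations agreeing with `σ₀` on `R`. -/
theorem sum_pow_cycleCount_of_agree {N : ℕ} (θ : ℝ) (n : ℕ) :
    ∀ (R : Finset (Fin N)) (σ₀ : Equiv.Perm (Fin N)), R.card + n = N →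
      ∑ σ ∈ (Finset.univ : Finset (Equiv.Perm (Fin N))).filter (fun σ => ∀ x ∈ R, σ x = σ₀ x),
        θ ^ cycleCount σ = θ ^ cyclesInside σ₀ R * ∏ k ∈ Finset.range n, (θ + (k : ℝ)) := by
  induction n with
  | zero =>
    intro R σ₀ hR
    obtain rfl : R = Finset.univ := by
      rw [← Finset.card_eq_iff_eq_univ, Fintype.card_fin]
      simpa using hR
    have : (Finset.univ : Finset (Equiv.Perm (Fin N))).filter
        (fun σ => ∀ x ∈ (Finset.univ : Finset (Fin N)), σ x = σ₀ x) = {σ₀} := by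
      ext σ
      simp [Equiv.ext_iff]
    rw [this, Finset.sum_singleton, cyclesInside_univ]
    simp
  | succ n ih =>
    intro R σ₀ hR
    obtain ⟨a, ha⟩ : ∃ a, a ∉ R := by
      by_contra! h
      have h2 := Finset.card_eq_iff_eq_univ R |>.2 (Finset.eq_univ_of_forall h)
      rw [Fintype.card_fin] at h2
      omega
    obtain ⟨β, hβ, hclose⟩ := exists_closing_value σ₀ ha
    have hmaps : ∀ σ ∈ (Finset.univ : Finset (Equiv.Perm (Fin N))).filter
        (fun σ => ∀ x ∈ R, σ x = σ₀ x), σ a ∈ (R.image σ₀)ᶜ := by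
      intro σ hσ
      rw [Finset.mem_compl, Finset.mem_image]
      rintro ⟨x, hx, hxa⟩
      rw [← (Finset.mem_filter.1 hσ).2 x hx] at hxa
      exact ha (σ.injective hxa ▸ hx)
    have hcard : ((R.image σ₀)ᶜ).card = n + 1 := by
      rw [Finset.card_compl, Finset.card_image_of_injective _ σ₀.injective, Fintype.card_fin]
      omega
    have hfiber : ∀ b ∈ (R.image σ₀)ᶜ,
        ∑ σ ∈ ((Finset.univ : Finset (Equiv.Perm (Fin N))).filter
          (fun σ => ∀ x ∈ R, σ x = σ₀ x)).filter (fun σ => σ a = b), θ ^ cycleCount σ =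
        θ ^ cyclesInside σ₀ R * (∏ k ∈ Finset.range n, (θ + (k : ℝ))) *
          (if b = β then θ else 1) := by
      intro b hb
      set τ : Equiv.Perm (Fin N) := Equiv.swap b (σ₀ a) * σ₀ with hτ
      have hτa : τ a = b := by simp [hτ]
      have hτR : ∀ x ∈ R, τ x = σ₀ x := by
        intro x hx
        rw [hτ, Equiv.Perm.mul_apply, Equiv.swap_apply_of_ne_of_ne]
        · rintro rfl
          exact Finset.mem_compl.1 hb (Finset.mem_image_of_mem σ₀ hx)
        · intro h
          exact ha (σ₀.injective h ▸ hx)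
      have hfil : ((Finset.univ : Finset (Equiv.Perm (Fin N))).filter
          (fun σ => ∀ x ∈ R, σ x = σ₀ x)).filter (fun σ => σ a = b) =
          Finset.univ.filter (fun σ => ∀ x ∈ insert a R, σ x = τ x) := by
        ext σ
        simp only [Finset.mem_filter, Finset.mem_univ, true_and, Finset.forall_mem_insert, hτa]
        rw [and_comm]
        refine and_congr_right fun _ => forall₂_congr fun x hx => ?_
        rw [hτR x hx]
      rw [hfil, ih (insert a R) τ (by rw [Finset.card_insert_of_notMem ha]; omega),
        cyclesInside_insert τ ha, cyclesInside_congr hτR]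
      simp only [hclose τ hτR, hτa]
      split_ifs <;> ring
    rw [← Finset.sum_fiberwise_of_maps_to hmaps, Finset.sum_congr rfl hfiber, ← Finset.mul_sum]
    have hsum : ∑ b ∈ (R.image σ₀)ᶜ, (if b = β then θ else 1) = θ + n := by
      have hβ' : β ∈ (R.image σ₀)ᶜ := Finset.mem_compl.2 hβ
      rw [← Finset.add_sum_erase _ _ hβ', if_pos rfl,
        Finset.sum_congr rfl (fun b hb => if_neg (Finset.ne_of_mem_erase hb)),
        Finset.sum_const, Finset.card_erase_of_mem hβ', hcard]
      simp
    rw [hsum, Finset.prod_range_succ]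
    ring

/-- Lemma 2.1: joint moments of the elementary events of an Ewens(θ) random permutation in
the case of distinct indices:
`E[B_{i_1,s_1} ⋯ B_{i_r,s_r}] = θ^c / ((N+θ−1)(N+θ−2)⋯(N+θ−r))`. -/
theorem ewens_joint_moment (θ : ℝ) (hθ : 0 < θ) (N r : ℕ) (hN : 1 ≤ N) (hr : r ≤ N)
    (i s : Fin r → Fin N) (hi : Function.Injective i) (hs : Function.Injective s) :
    ewensE θ N (fun σ => ∏ j, Bis (i j) (s j) σ) =
      θ ^ partialCycles i s / ∏ k ∈ Finset.range r, ((N : ℝ) + θ - ((k : ℝ) + 1)) := by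
  obtain ⟨σ₀, hσ₀⟩ : ∃ σ₀ : Equiv.Perm (Fin N), ∀ j, σ₀ (i j) = s j :=
    Equiv.Perm.exists_extending_pair i s hi hs
  obtain ⟨n, rfl⟩ := Nat.exists_eq_add_of_le' hr
  have hcard : (Finset.univ.image i).card + n = n + r := by
    rw [Finset.card_image_of_injective _ hi, Finset.card_univ, Fintype.card_fin, add_comm]
  have hsum := sum_pow_cycleCount_of_agree θ n (Finset.univ.image i) σ₀ hcard
  rw [Finset.sum_filter] at hsum
  have hBis : ∀ σ : Equiv.Perm (Fin (n + r)), θ ^ cycleCount σ * ∏ j, Bis (i j) (s j) σ =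
      if ∀ x ∈ Finset.univ.image i, σ x = σ₀ x then θ ^ cycleCount σ else 0 := by
    intro σ
    simp only [Bis, Finset.prod_ite_zero, Finset.prod_const_one, mul_ite, mul_one, mul_zero,
      Finset.forall_mem_image, hσ₀]
  have hprod : ∏ k ∈ Finset.range (n + r), (θ + (k : ℝ)) =
      (∏ k ∈ Finset.range n, (θ + (k : ℝ))) *
        ∏ k ∈ Finset.range r, (((n + r : ℕ) : ℝ) + θ - ((k : ℝ) + 1)) := by
    rw [Finset.prod_range_add, ← Finset.prod_range_reflect _ r]
    congr 1
    refine Finset.prod_congr rfl fun k hk => ?_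
    have hk' : k + 1 ≤ r := Finset.mem_range.1 hk
    rw [Nat.sub_sub, add_comm 1 k]
    push_cast [Nat.cast_sub hk']
    ring
  have hpos : ∏ k ∈ Finset.range n, (θ + (k : ℝ)) ≠ 0 :=
    (Finset.prod_pos fun k _ => by positivity).ne'
  rw [ewensE, Finset.sum_congr rfl fun σ _ => hBis σ, hsum, hprod,
    partialCycles_eq_cyclesInside hi σ₀ hσ₀, mul_comm (θ ^ _), mul_div_mul_left _ _ hpos]

end
end

section
/- Let L ≥ 1 be an integer and, for each pair {j,k} ⊆ [L] with j < k, let D_{{j,k}} be a finite set of integers. To a list (i_1, …, i_L) of integers associate the graph on vertex set [L] whose edges are the pairs {j,k} (j < k) with i_k − i_j ∈ D_{{j,k}}. Then there exists a constant C (depending only on L and on the family (D_{{j,k}})) such that, for every N ≥ 1 and every t ≤ L, the number of lists (i_1, …, i_L) with entries in [N] whose associated graph has exactly t connected components is at most C · N^t. -/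
open scoped Classical

/-- If the values of `f` at adjacent vertices differ by at most `M`, then its values at two vertices
of the same connected component differ by at most `M` times the number of vertices. -/
theorem SimpleGraph.Reachable.abs_sub_le_mul_card {V : Type*} [Fintype V] {G : SimpleGraph V}
    {f : V → ℤ} {M : ℕ} (hf : ∀ u v, G.Adj u v → |f u - f v| ≤ M) {u v : V}
    (h : G.Reachable u v) : |f u - f v| ≤ M * Fintype.card V := by
  have hwalk : ∀ {a b : V} (p : G.Walk a b), |f a - f b| ≤ M * p.length := by
    intro a b p
    induction p with
    | nil => simp
    | cons hadj p ih =>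
      rw [SimpleGraph.Walk.length_cons]
      push_cast
      linarith [hf _ _ hadj, abs_sub_le (f _) (f _) (f _) |>.trans (add_le_add (hf _ _ hadj) ih)]
  obtain ⟨p, hp⟩ := h.exists_isPath
  refine (hwalk p).trans ?_
  have := hp.length_lt
  gcongr

/-- The number of `Fin N`-labellings of the vertices of `G` varying by at most `M` along each edge
is at most a constant times `N` to the number of connected components of `G`. -/
theorem SimpleGraph.card_filter_adj_abs_sub_le {V : Type*} [Fintype V] (G : SimpleGraph V)
    (M N : ℕ) :
    (Finset.univ.filter (fun i : V → Fin N =>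
        ∀ u v, G.Adj u v → |(i u : ℤ) - (i v : ℤ)| ≤ M)).card ≤
      (2 * (M * Fintype.card V) + 1) ^ Fintype.card V * N ^ Nat.card G.ConnectedComponent := by
  set B : ℕ := M * Fintype.card V with hB
  let rep : V → V := fun v => (G.connectedComponentMk v).out
  have hrep : ∀ v, G.Reachable v (rep v) := fun v =>
    (SimpleGraph.ConnectedComponent.exact (Quot.out_eq (G.connectedComponentMk v))).symm
  let F : (V → Fin N) → (V → ℤ) × (G.ConnectedComponent → Fin N) := fun i =>
    (fun v => (i v : ℤ) - (i (rep v) : ℤ), fun c => i c.out)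
  let T : Finset ((V → ℤ) × (G.ConnectedComponent → Fin N)) :=
    Fintype.piFinset (fun _ : V => Finset.Icc (-(B : ℤ)) B) ×ˢ Finset.univ
  have hT : T.card = (2 * B + 1) ^ Fintype.card V * N ^ Nat.card G.ConnectedComponent := by
    have hIcc : ((B : ℤ) + 1 + B).toNat = 2 * B + 1 := by omega
    simp [T, Finset.card_product, Fintype.card_piFinset, hIcc]
  rw [← hT]
  refine Finset.card_le_card_of_injOn F (fun i hi => ?_) (fun i _ j _ hij => ?_)
  · have hi' := (Finset.mem_filter.1 (Finset.mem_coe.1 hi)).2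
    refine Finset.mem_coe.2 (Finset.mem_product.2 ⟨Fintype.mem_piFinset.2 fun v => ?_,
      Finset.mem_univ _⟩)
    have h := (hrep v).abs_sub_le_mul_card (f := fun v => (i v : ℤ)) hi'
    rw [Finset.mem_Icc, ← abs_le, hB]
    push_cast
    exact h
  · funext v
    have h₁ := congrFun (congrArg Prod.fst hij) v
    have h₂ : i (rep v) = j (rep v) :=
      congrFun (congrArg Prod.snd hij) (G.connectedComponentMk v)
    simp only [F, h₂, sub_left_inj, Nat.cast_inj] at h₁
    exact Fin.ext h₁

/-- Lemma 6.1: given finite sets of integers `D_{j,k}` for pairs `j < k` in `[L]`,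
associate to a list `i` the graph on `[L]` whose edges are the pairs `{j,k}` (`j < k`) with
`i_k − i_j ∈ D_{j,k}`.  There is a constant `C` such that for every `N ≥ 1` and `t ≤ L`,
the number of lists with entries in `[N]` whose graph has exactly `t` connected components
is at most `C · N^t`. -/
theorem count_lists_graph_components (L : ℕ) (hL : 1 ≤ L) (D : Fin L → Fin L → Finset ℤ) :
    ∃ C : ℕ, ∀ N : ℕ, 1 ≤ N → ∀ t : ℕ, t ≤ L →
      ((Finset.univ : Finset (Fin L → Fin N)).filter
          (fun i => Nat.card (SimpleGraph.fromRel (fun j k : Fin L =>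
              (j < k ∧ (i k : ℤ) - (i j : ℤ) ∈ D j k) ∨
              (k < j ∧ (i j : ℤ) - (i k : ℤ) ∈ D k j))).ConnectedComponent = t)).card
        ≤ C * N ^ t := by
  obtain ⟨M, hM⟩ : ∃ M : ℕ, ∀ j k, ∀ d ∈ D j k, |d| ≤ (M : ℤ) := by
    refine ⟨∑ j, ∑ k, ∑ d ∈ D j k, d.natAbs, fun j k d hd => ?_⟩
    rw [Int.abs_eq_natAbs]
    refine Int.ofNat_le.2 ?_
    calc d.natAbs ≤ ∑ d ∈ D j k, d.natAbs :=
          Finset.single_le_sum (f := Int.natAbs) (fun _ _ => Nat.zero_le _) hd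
      _ ≤ ∑ k, ∑ d ∈ D j k, d.natAbs :=
          Finset.single_le_sum (f := fun k => ∑ d ∈ D j k, d.natAbs)
            (fun _ _ => Nat.zero_le _) (Finset.mem_univ k)
      _ ≤ ∑ j, ∑ k, ∑ d ∈ D j k, d.natAbs :=
          Finset.single_le_sum (f := fun j => ∑ k, ∑ d ∈ D j k, d.natAbs)
            (fun _ _ => Nat.zero_le _) (Finset.mem_univ j)
  let K : ℕ := (2 * (M * Fintype.card (Fin L)) + 1) ^ Fintype.card (Fin L)
  refine ⟨Fintype.card (SimpleGraph (Fin L)) * K, fun N _ t _ => ?_⟩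
  let S : SimpleGraph (Fin L) → Finset (Fin L → Fin N) := fun G =>
    Finset.univ.filter (fun i => ∀ u v, G.Adj u v → |(i u : ℤ) - (i v : ℤ)| ≤ M)
  let 𝒢 : Finset (SimpleGraph (Fin L)) :=
    Finset.univ.filter (fun G => Nat.card G.ConnectedComponent = t)
  calc _ ≤ (𝒢.biUnion S).card := by
        refine Finset.card_le_card fun i hi => ?_
        rw [Finset.mem_biUnion]
        refine ⟨_, Finset.mem_filter.2 ⟨Finset.mem_univ _, (Finset.mem_filter.1 hi).2⟩, ?_⟩
        simp only [S, Finset.mem_filter_univ]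
        intro u v huv
        rw [SimpleGraph.fromRel_adj] at huv
        rcases huv.2 with (⟨_, h⟩ | ⟨_, h⟩) | (⟨_, h⟩ | ⟨_, h⟩)
        · rw [abs_sub_comm]; exact hM _ _ _ h
        · exact hM _ _ _ h
        · exact hM _ _ _ h
        · rw [abs_sub_comm]; exact hM _ _ _ h
    _ ≤ 𝒢.card * (K * N ^ t) := by
        refine Finset.card_biUnion_le_card_mul _ _ _ fun G hG => ?_
        rw [← (Finset.mem_filter.1 hG).2]
        convert G.card_filter_adj_abs_sub_le M N
    _ ≤ Fintype.card (SimpleGraph (Fin L)) * K * N ^ t := by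
        rw [mul_assoc]
        exact Nat.mul_le_mul_right _ (Finset.card_le_univ _)
end
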